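/- arXiv:1503.03360 — 3 statements merged into one kernel-verified Lean document; each statement's English description precedes it below -/
import Mathlib

section
/- Let B̄ be a subdiagram of a Bratteli diagram B such that X_B̄ is a thin subset of X_B, i.e. μ(X_B̄) = 0 for every probability ergodic R-invariant measure μ on X_B. Then for every probability measure μ̄ on X_B̄ invariant with respect to the tail equivalence relation of B̄, the extension μ̂ of μ̄ to the saturation X̂_B̄ satisfies μ̂(X̂_B̄) = ∞. -/
open MeasureTheory

/-- A Bratteli diagram. -/
structure BratteliDiagram where
  V : ℕ → Type
  E : ℕ → Type
  fintypeV : ∀ n, Fintype (V n)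
  fintypeE : ∀ n, Fintype (E n)
  nonemptyV : ∀ n, Nonempty (V n)
  nonemptyE : ∀ n, Nonempty (E n)
  root_subsingleton : ∀ v w : V 0, v = w
  src : ∀ n, E n → V n
  rng : ∀ n, E n → V (n + 1)
  src_surj : ∀ n, Function.Surjective (src n)
  rng_surj : ∀ n, Function.Surjective (rng n)

attribute [instance] BratteliDiagram.fintypeV BratteliDiagram.fintypeE
  BratteliDiagram.nonemptyV BratteliDiagram.nonemptyE

namespace BratteliDiagram

variable (B : BratteliDiagram)

instance (n : ℕ) : TopologicalSpace (B.E n) := ⊥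

/-- The path space `X_B` of a Bratteli diagram. -/
def PathSpace : Type :=
  { x : ∀ n, B.E n // ∀ n, B.rng n (x n) = B.src (n + 1) (x (n + 1)) }

instance : TopologicalSpace B.PathSpace := by unfold PathSpace; infer_instance

noncomputable instance : MeasurableSpace B.PathSpace := borel _

/-- The vertex at level `n` through which a path passes. -/
def endVtx (n : ℕ) (x : B.PathSpace) : B.V n := B.src n (x.1 n)

/-- The cylinder set of paths agreeing with `x` on the first `n` edges. -/
def cyl (n : ℕ) (x : B.PathSpace) : Set B.PathSpace := { y | ∀ i < n, y.1 i = x.1 i }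

/-- Tail equivalence of paths. -/
def tailEq (x y : B.PathSpace) : Prop := ∃ N, ∀ n, N ≤ n → x.1 n = y.1 n

/-- The tail equivalence relation is aperiodic: all classes are infinite. -/
def TailAperiodic : Prop := ∀ x : B.PathSpace, { y | B.tailEq x y }.Infinite

/-- A measure is invariant for the tail equivalence relation if any two
cylinder sets ending at the same vertex have equal measure. -/
def TailInvariant (μ : Measure B.PathSpace) : Prop :=
  ∀ (n : ℕ) (x y : B.PathSpace), B.endVtx n x = B.endVtx n y →
    μ (B.cyl n x) = μ (B.cyl n y)

/-- Ergodicity with respect to the tail equivalence relation. -/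
def TailErgodic (μ : Measure B.PathSpace) : Prop :=
  ∀ S : Set B.PathSpace, MeasurableSet S →
    (∀ x y, B.tailEq x y → (x ∈ S ↔ y ∈ S)) → μ S = 0 ∨ μ Sᶜ = 0

/-- The type of finite paths from the root vertex to `v`. -/
def FinPathTo : ∀ n, B.V n → Type
  | 0, _ => PUnit
  | n + 1, v => Σ e : { e : B.E n // B.rng n e = v }, FinPathTo n (B.src n e.1)

/-- The height `h_v^{(n)}`: the number of finite paths from the root to `v`. -/
noncomputable def height (n : ℕ) (v : B.V n) : ℕ := Nat.card (B.FinPathTo n v)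

/-- The number of edges from `w ∈ V_n` to `v ∈ V_{n+1}`; the entry `f^{(n)}_{v,w}`
of the incidence matrix `F_n`. -/
noncomputable def edgeCount (n : ℕ) (v : B.V (n + 1)) (w : B.V n) : ℕ :=
  Nat.card { e : B.E n // B.rng n e = v ∧ B.src n e = w }

/-- The incidence matrix `F_n`, as a real matrix. -/
noncomputable def incMat (n : ℕ) : Matrix (B.V (n + 1)) (B.V n) ℝ :=
  fun v w => (B.edgeCount n v w : ℝ)

end BratteliDiagram

namespace BratteliDiagram

variable (B : BratteliDiagram)

/-- The path space of the vertex subdiagram determined by the vertex sets `W` :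
infinite paths of `B` passing through `W_n` at every level `n ≥ 1`. -/
def vertexSubPaths (W : ∀ n, Finset (B.V n)) : Set B.PathSpace :=
  { x | ∀ n : ℕ, B.endVtx (n + 1) x ∈ W (n + 1) }

/-- The saturation of a set of paths with respect to the tail equivalence relation. -/
def saturation (S : Set B.PathSpace) : Set B.PathSpace := { x | ∃ y ∈ S, B.tailEq x y }

/-- The image of `A ⊆ X_B` under the prefix exchange replacing the first `n` edges by
those of `y`. -/
def swapped (n : ℕ) (y : B.PathSpace) (A : Set B.PathSpace) : Set B.PathSpace :=
  { w | (∀ i < n, w.1 i = y.1 i) ∧ ∃ z ∈ A, ∀ i : ℕ, n ≤ i → w.1 i = z.1 i }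

/-- Invariance with respect to the tail equivalence relation, in the strong sense: every
prefix exchange between two cylinders with the same end vertex is measure preserving. -/
def StrongTailInvariant (μ : Measure B.PathSpace) : Prop :=
  ∀ (n : ℕ) (x y : B.PathSpace), B.endVtx n x = B.endVtx n y →
    ∀ A : Set B.PathSpace, A ⊆ B.cyl n x → MeasurableSet A →
      μ (B.swapped n y A) = μ A

/-- Invariance of a measure supported on `S` with respect to the tail equivalence
relation of the subdiagram with path space `S`: relative cylinder sets with the same
end vertex have equal measure. -/
def TailInvariantOn (S : Set B.PathSpace) (μ : Measure B.PathSpace) : Prop :=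
  ∀ (n : ℕ) (x y : B.PathSpace), x ∈ S → y ∈ S → B.endVtx n x = B.endVtx n y →
    μ (B.cyl n x ∩ S) = μ (B.cyl n y ∩ S)

end BratteliDiagram

namespace BratteliDiagram

/-- The path space of the subdiagram of `B` consisting of the edges in `Es`. -/
def edgeSubPaths (B : BratteliDiagram) (Es : ∀ n, Finset (B.E n)) : Set B.PathSpace :=
  { x | ∀ n : ℕ, x.1 n ∈ Es n }

end BratteliDiagram

namespace BratteliDiagram

variable (B : BratteliDiagram)

instance (n : ℕ) : DiscreteTopology (B.E n) := ⟨rfl⟩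

instance : BorelSpace B.PathSpace := ⟨rfl⟩

lemma isEmbedding_val :
    Topology.IsEmbedding (fun x : B.PathSpace => (x.1 : ∀ n, B.E n)) :=
  Topology.IsEmbedding.subtypeVal

lemma continuous_edge (n : ℕ) : Continuous fun x : B.PathSpace => x.1 n :=
  (continuous_apply n).comp B.isEmbedding_val.continuous

lemma isClosedEmbedding_val :
    Topology.IsClosedEmbedding (fun x : B.PathSpace => (x.1 : ∀ n, B.E n)) := by
  refine ⟨B.isEmbedding_val, ?_⟩
  have hrange : Set.range (fun x : B.PathSpace => (x.1 : ∀ n, B.E n)) =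
      ⋂ n, {x | B.rng n (x n) = B.src (n + 1) (x (n + 1))} := by
    ext x
    simp only [Set.mem_range, Set.mem_iInter, Set.mem_ofPred_eq]
    exact ⟨by rintro ⟨y, rfl⟩; exact y.2, fun h => ⟨⟨x, h⟩, rfl⟩⟩
  rw [hrange]
  refine isClosed_iInter fun n => ?_
  exact (isClosed_discrete {p : B.E n × B.E (n + 1) | B.rng n p.1 = B.src (n + 1) p.2}).preimage
    ((continuous_apply n).prodMk (continuous_apply (n + 1)))

instance : CompactSpace B.PathSpace := B.isClosedEmbedding_val.compactSpace

instance : TopologicalSpace.MetrizableSpace B.PathSpace :=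
  B.isEmbedding_val.metrizableSpace

instance : SecondCountableTopology B.PathSpace :=
  B.isEmbedding_val.secondCountableTopology

variable {B}

lemma mem_cyl_self (n : ℕ) (x : B.PathSpace) : x ∈ B.cyl n x := fun _ _ => rfl

lemma cyl_eq_of_mem {n : ℕ} {x y : B.PathSpace} (h : y ∈ B.cyl n x) : B.cyl n y = B.cyl n x := by
  ext z
  exact ⟨fun hz i hi => (hz i hi).trans (h i hi), fun hz i hi => (hz i hi).trans (h i hi).symm⟩

lemma endVtx_eq_of_mem_cyl {n : ℕ} {x y : B.PathSpace} (h : y ∈ B.cyl n x) :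
    B.endVtx n y = B.endVtx n x := by
  cases n with
  | zero => exact B.root_subsingleton _ _
  | succ k => rw [endVtx, endVtx, ← y.2 k, ← x.2 k, h k k.lt_succ_self]

lemma isClopen_cyl (n : ℕ) (x : B.PathSpace) : IsClopen (B.cyl n x) := by
  have h : B.cyl n x = ⋂ i ∈ Finset.range n, {y : B.PathSpace | y.1 i = x.1 i} := by
    ext y
    simp [cyl]
  rw [h]
  exact isClopen_biInter_finset fun i _ =>
    (isClopen_discrete {x.1 i}).preimage (B.continuous_edge i)

lemma measurableSet_cyl (n : ℕ) (x : B.PathSpace) : MeasurableSet (B.cyl n x) :=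
  (isClopen_cyl n x).isOpen.measurableSet

lemma isClosed_edgeSubPaths (Es : ∀ n, Finset (B.E n)) : IsClosed (B.edgeSubPaths Es) := by
  have h : B.edgeSubPaths Es = ⋂ n, {x : B.PathSpace | x.1 n ∈ Es n} := by
    ext y
    simp [edgeSubPaths]
  rw [h]
  exact isClosed_iInter fun n =>
    (isClosed_discrete (Es n : Set (B.E n))).preimage (B.continuous_edge n)

variable (B) in
/-- The cylinder sets of length at least `n`. -/
def cylsFrom (n : ℕ) : Set (Set B.PathSpace) := {s | ∃ m, n ≤ m ∧ ∃ z, s = B.cyl m z}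

lemma isPiSystem_cylsFrom (n : ℕ) : IsPiSystem (B.cylsFrom n) := by
  rintro _ ⟨m, hm, z, rfl⟩ _ ⟨k, -, w, rfl⟩ ⟨y, hy, hy'⟩
  refine ⟨max m k, hm.trans (le_max_left _ _), y, ?_⟩
  rw [← cyl_eq_of_mem hy, ← cyl_eq_of_mem hy']
  ext u
  simp only [cyl, Set.mem_inter_iff, Set.mem_ofPred_eq, lt_max_iff]
  exact ⟨fun h i hi => hi.elim (h.1 i) (h.2 i), fun h => ⟨fun i hi => h i (.inl hi),
    fun i hi => h i (.inr hi)⟩⟩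

lemma isTopologicalBasis_cylsFrom (n : ℕ) :
    TopologicalSpace.IsTopologicalBasis (B.cylsFrom n) := by
  refine TopologicalSpace.isTopologicalBasis_of_isOpen_of_nhds ?_ ?_
  · rintro _ ⟨m, -, z, rfl⟩
    exact (isClopen_cyl m z).isOpen
  · intro a u ha hu
    obtain ⟨U, hU, rfl⟩ := B.isEmbedding_val.isOpen_iff.1 hu
    obtain ⟨I, v, hv, hIv⟩ := isOpen_pi_iff.1 hU _ ha
    refine ⟨_, ⟨max n (I.sup id + 1), le_max_left _ _, a, rfl⟩, mem_cyl_self _ a,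
      fun y hy => hIv fun i hi => ?_⟩
    have hlt : i < max n (I.sup id + 1) :=
      lt_max_of_lt_right (Nat.lt_succ_of_le (Finset.le_sup (f := id) hi))
    have hyi : y.1 i = a.1 i := hy i hlt
    change y.1 i ∈ v i
    rw [hyi]
    exact (hv i hi).2

lemma generateFrom_cylsFrom (n : ℕ) :
    (inferInstance : MeasurableSpace B.PathSpace) = .generateFrom (B.cylsFrom n) :=
  borel_eq_generateFrom_of_subbasis (isTopologicalBasis_cylsFrom n).eq_generateFrom

open Classical in
/-- Replace the first `n` edges of `z` by those of `y` whenever this gives a path,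
and leave `z` unchanged otherwise. -/
noncomputable def splice (n : ℕ) (y z : B.PathSpace) : B.PathSpace :=
  ⟨fun i => if B.endVtx n y = B.endVtx n z ∧ i < n then y.1 i else z.1 i, by
    intro i
    by_cases h : B.endVtx n y = B.endVtx n z
    · rcases lt_trichotomy (i + 1) n with hi | hi | hi
      · simpa [h, hi, (Nat.lt_succ_self i).trans hi] using y.2 i
      · subst hi
        simpa [h] using (y.2 i).trans (show B.src (i + 1) _ = B.src (i + 1) _ from h)
      · simpa [h, hi.not_gt, (Nat.lt_succ_iff.1 hi).not_gt] using z.2 i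
    · simpa [h] using z.2 i⟩

lemma splice_of_lt {n : ℕ} {y z : B.PathSpace} (h : B.endVtx n y = B.endVtx n z) {i : ℕ}
    (hi : i < n) : (splice n y z).1 i = y.1 i := if_pos ⟨h, hi⟩

lemma splice_of_le {n : ℕ} (y z : B.PathSpace) {i : ℕ} (hi : n ≤ i) :
    (splice n y z).1 i = z.1 i := if_neg fun h => hi.not_gt h.2

lemma tailEq_splice (n : ℕ) (y z : B.PathSpace) : B.tailEq (splice n y z) z :=
  ⟨n, fun _ hi => splice_of_le y z hi⟩

lemma continuous_splice (n : ℕ) (y : B.PathSpace) : Continuous (splice n y) := by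
  classical
  refine B.isEmbedding_val.continuous_iff.2 (continuous_pi fun i => ?_)
  exact (continuous_of_discreteTopology (f := fun p : B.E n × B.E i =>
    if B.endVtx n y = B.src n p.1 ∧ i < n then y.1 i else p.2)).comp
    ((B.continuous_edge n).prodMk (B.continuous_edge i))

lemma TailInvariant.map_splice {μ : Measure B.PathSpace} [IsFiniteMeasure μ]
    (hμ : B.TailInvariant μ) {n : ℕ} {x y : B.PathSpace} (h : B.endVtx n x = B.endVtx n y) :
    (μ.restrict (B.cyl n x)).map (splice n y) = μ.restrict (B.cyl n y) := by
  have hmeas := (continuous_splice n y).measurable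
  have hend : ∀ w ∈ B.cyl n x, B.endVtx n y = B.endVtx n w := fun w hw =>
    (h.symm.trans (endVtx_eq_of_mem_cyl hw).symm)
  refine ext_of_generate_finite _ (generateFrom_cylsFrom n) (isPiSystem_cylsFrom n) ?_ ?_
  · rintro _ ⟨m, hm, z, rfl⟩
    rw [Measure.map_apply hmeas (measurableSet_cyl m z),
      Measure.restrict_apply (hmeas (measurableSet_cyl m z)),
      Measure.restrict_apply (measurableSet_cyl m z)]
    by_cases hz : z ∈ B.cyl n y
    · have hxz : B.endVtx n x = B.endVtx n z := h.trans (endVtx_eq_of_mem_cyl hz).symm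
      have h₁ : splice n y ⁻¹' B.cyl m z ∩ B.cyl n x = B.cyl m (splice n x z) := by
        ext w
        constructor
        · rintro ⟨hw, hwx⟩ i hi
          rcases lt_or_ge i n with hin | hin
          · rw [splice_of_lt hxz hin, hwx i hin]
          · rw [splice_of_le x z hin, ← hw i hi, splice_of_le y w hin]
        · intro hw
          have hwx : w ∈ B.cyl n x := fun i hi => by
            rw [hw i (hi.trans_le hm), splice_of_lt hxz hi]
          refine ⟨fun i hi => ?_, hwx⟩
          rcases lt_or_ge i n with hin | hin
          · rw [splice_of_lt (hend w hwx) hin, hz i hin]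
          · rw [splice_of_le y w hin, hw i hi, splice_of_le x z hin]
      have h₂ : B.cyl m z ∩ B.cyl n y = B.cyl m z :=
        Set.inter_eq_left.2 fun w hw i hi => (hw i (hi.trans_le hm)).trans (hz i hi)
      rw [h₁, h₂]
      exact hμ m _ _ (congrArg (B.src m) (splice_of_le x z hm))
    · have h₁ : splice n y ⁻¹' B.cyl m z ∩ B.cyl n x = ∅ := by
        refine Set.eq_empty_of_forall_notMem fun w hw => hz fun i hi => ?_
        rw [← hw.1 i (hi.trans_le hm), splice_of_lt (hend w hw.2) hi]
      have h₂ : B.cyl m z ∩ B.cyl n y = ∅ :=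
        Set.eq_empty_of_forall_notMem fun w hw => hz fun i hi =>
          (hw.1 i (hi.trans_le hm)).symm.trans (hw.2 i hi)
      rw [h₁, h₂]
  · rw [Measure.map_apply hmeas .univ, Set.preimage_univ, Measure.restrict_apply_univ,
      Measure.restrict_apply_univ, hμ n x y h]

lemma TailInvariant.cond {μ : Measure B.PathSpace} [IsFiniteMeasure μ]
    (hμ : B.TailInvariant μ) {S : Set B.PathSpace} (hS : MeasurableSet S)
    (hinv : ∀ x y, B.tailEq x y → (x ∈ S ↔ y ∈ S)) :
    B.TailInvariant (ProbabilityTheory.cond μ S) := by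
  intro n x y h
  have hpre : splice n y ⁻¹' S = S := by
    ext z
    exact hinv _ _ (tailEq_splice n y z)
  have key : μ (S ∩ B.cyl n x) = μ (S ∩ B.cyl n y) := by
    have := congrArg (· S) (hμ.map_splice h)
    simpa [Measure.map_apply (continuous_splice n y).measurable hS, hpre,
      Measure.restrict_apply hS] using this
  rw [ProbabilityTheory.cond_apply hS, ProbabilityTheory.cond_apply hS, key]

lemma upperSemicontinuous_measure_closed {F : Set B.PathSpace} (hF : IsClosed F) :
    UpperSemicontinuous fun μ : ProbabilityMeasure B.PathSpace => (μ : Measure B.PathSpace) F :=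
  fun μ _ hlt => Filter.eventually_lt_of_limsup_lt
    ((ProbabilityMeasure.limsup_measure_closed_le_of_tendsto Filter.tendsto_id hF).trans_lt hlt)

lemma continuous_measureReal_isClopen {F : Set B.PathSpace} (hF : IsClopen F) :
    Continuous fun μ : ProbabilityMeasure B.PathSpace => (μ : Measure B.PathSpace).real F :=
  continuous_iff_continuousAt.2 fun _ => (NNReal.continuous_coe.tendsto _).comp
    (ProbabilityMeasure.tendsto_measure_of_isClopen_of_tendsto Filter.tendsto_id hF)

variable (B) in
/-- The values of a probability measure on all cylinder sets. -/
noncomputable def cylValues (μ : ProbabilityMeasure B.PathSpace) : ℕ × B.PathSpace → ℝ :=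
  fun p => (μ : Measure B.PathSpace).real (B.cyl p.1 p.2)

lemma continuous_cylValues : Continuous B.cylValues :=
  continuous_pi fun p => continuous_measureReal_isClopen (isClopen_cyl p.1 p.2)

lemma cylValues_injective : Function.Injective B.cylValues := by
  intro μ ν h
  suffices (μ : Measure B.PathSpace) = ν from Subtype.ext this
  refine ext_of_generate_finite _ (generateFrom_cylsFrom 0) (isPiSystem_cylsFrom 0) ?_ (by simp)
  rintro _ ⟨m, -, z, rfl⟩
  exact (measureReal_eq_measureReal_iff).1 (congrFun h (m, z))

lemma isClosed_tailInvariant :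
    IsClosed {μ : ProbabilityMeasure B.PathSpace | B.TailInvariant μ} := by
  have h : {μ : ProbabilityMeasure B.PathSpace | B.TailInvariant μ} =
      ⋂ (n : ℕ) (x : B.PathSpace) (y : B.PathSpace) (_ : B.endVtx n x = B.endVtx n y),
        {μ | B.cylValues μ (n, x) = B.cylValues μ (n, y)} := by
    ext μ
    simp only [Set.mem_iInter]
    exact forall₄_congr fun n x y _ => (measureReal_eq_measureReal_iff).symm
  rw [h]
  exact isClosed_iInter fun n => isClosed_iInter fun x => isClosed_iInter fun y =>
    isClosed_iInter fun _ => isClosed_eq ((continuous_apply (n, x)).comp continuous_cylValues)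
      ((continuous_apply (n, y)).comp continuous_cylValues)

lemma le_left_of_convex_combination {a b p q m : ℝ} (ha : 0 < a) (hb : 0 ≤ b) (hab : a + b = 1)
    (h : a * p + b * q = m) (hq : q ≤ m) : m ≤ p := by
  have hbq := mul_le_mul_of_nonneg_left hq hb
  have hm : a * m + b * m = m := by rw [← add_mul, hab, one_mul]
  exact le_of_mul_le_mul_left (by linarith) ha

/-- Among the tail-invariant probability measures, those giving maximal mass to a closed set
include an ergodic one. -/
theorem exists_tailErgodic_le {F : Set B.PathSpace} (hF : IsClosed F)
    (ν : ProbabilityMeasure B.PathSpace) (hν : B.TailInvariant ν) :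
    ∃ μ : ProbabilityMeasure B.PathSpace, B.TailInvariant μ ∧ B.TailErgodic μ ∧
      (ν : Measure B.PathSpace) F ≤ (μ : Measure B.PathSpace) F := by
  set I := {μ : ProbabilityMeasure B.PathSpace | B.TailInvariant μ}
  have husc := upperSemicontinuous_measure_closed hF
  obtain ⟨μ₀, hμ₀, hmax⟩ := (husc.upperSemicontinuousOn I).exists_isMaxOn ⟨ν, hν⟩
    isClosed_tailInvariant.isCompact
  set M := I ∩ {μ | (μ₀ : Measure B.PathSpace) F ≤ (μ : Measure B.PathSpace) F}
  have hM : IsCompact M :=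
    (isClosed_tailInvariant.inter (husc.isClosed_preimage _)).isCompact
  obtain ⟨_, ⟨μ, hμM, rfl⟩, hext⟩ := (hM.image continuous_cylValues).extremePoints_nonempty
    (Set.Nonempty.image _ ⟨μ₀, hμ₀, le_refl ((μ₀ : Measure B.PathSpace) F)⟩)
  refine ⟨μ, hμM.1, fun S hS hinv => ?_, (hmax hν).trans hμM.2⟩
  by_contra! hne
  have hle : ∀ ρ ∈ I, (ρ : Measure B.PathSpace).real F ≤ (μ : Measure B.PathSpace).real F :=
    fun ρ hρ => ENNReal.toReal_mono (measure_ne_top _ _) ((hmax hρ).trans hμM.2)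
  let μ₁ : ProbabilityMeasure B.PathSpace :=
    ⟨_, ProbabilityTheory.cond_isProbabilityMeasure (μ := (μ : Measure B.PathSpace)) hne.1⟩
  let μ₂ : ProbabilityMeasure B.PathSpace :=
    ⟨_, ProbabilityTheory.cond_isProbabilityMeasure (μ := (μ : Measure B.PathSpace)) hne.2⟩
  have hμ₁ : μ₁ ∈ I := hμM.1.cond hS hinv
  have hμ₂ : μ₂ ∈ I := hμM.1.cond hS.compl fun x y h => not_congr (hinv x y h)
  have ha : 0 < (μ : Measure B.PathSpace).real S :=
    ENNReal.toReal_pos hne.1 (measure_ne_top _ _)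
  have hb : 0 < (μ : Measure B.PathSpace).real Sᶜ :=
    ENNReal.toReal_pos hne.2 (measure_ne_top _ _)
  have hab : (μ : Measure B.PathSpace).real S + (μ : Measure B.PathSpace).real Sᶜ = 1 := by
    rw [measureReal_add_measureReal_compl hS, probReal_univ]
  have hsplit : ∀ t, (μ : Measure B.PathSpace).real S * (μ₁ : Measure B.PathSpace).real t +
      (μ : Measure B.PathSpace).real Sᶜ * (μ₂ : Measure B.PathSpace).real t =
      (μ : Measure B.PathSpace).real t := fun t => by
    have := congrArg ENNReal.toReal
      (ProbabilityTheory.cond_add_cond_compl_eq (t := t) hS (μ : Measure B.PathSpace))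
    rw [ENNReal.toReal_add (ENNReal.mul_ne_top (measure_ne_top _ _) (measure_ne_top _ _))
      (ENNReal.mul_ne_top (measure_ne_top _ _) (measure_ne_top _ _)), ENNReal.toReal_mul,
      ENNReal.toReal_mul, mul_comm, mul_comm (ENNReal.toReal (ProbabilityTheory.cond _ Sᶜ t))] at this
    exact this
  have hmem : ∀ ρ ∈ I, (μ : Measure B.PathSpace).real F ≤ (ρ : Measure B.PathSpace).real F →
      ρ ∈ M := fun ρ hρ h => ⟨hρ, hμM.2.trans
        ((ENNReal.toReal_le_toReal (measure_ne_top _ _) (measure_ne_top _ _)).1 h)⟩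
  have hF₁ := hle _ hμ₁
  have hF₂ := hle _ hμ₂
  have hM₁ : μ₁ ∈ M := hmem _ hμ₁ (le_left_of_convex_combination ha hb.le hab (hsplit F) hF₂)
  have hM₂ : μ₂ ∈ M := hmem _ hμ₂ (le_left_of_convex_combination hb ha.le
    ((add_comm _ _).trans hab) ((add_comm _ _).trans (hsplit F)) hF₁)
  have heq : μ₁ = μ := cylValues_injective <|
    hext (Set.mem_image_of_mem _ hM₁) (Set.mem_image_of_mem _ hM₂)
      ⟨_, _, ha, hb, hab, funext fun p => hsplit _⟩
  have h₁ : (μ₁ : Measure B.PathSpace) Sᶜ = 0 := by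
    change ProbabilityTheory.cond _ S Sᶜ = 0
    rw [ProbabilityTheory.cond_apply hS, Set.inter_compl_self, measure_empty, mul_zero]
  rw [heq] at h₁
  exact hne.2 h₁

lemma StrongTailInvariant.tailInvariant {μ : Measure B.PathSpace}
    (hμ : B.StrongTailInvariant μ) : B.TailInvariant μ := by
  intro n x y h
  rw [← hμ n x y h _ subset_rfl (measurableSet_cyl n x)]
  congr 1
  ext w
  refine ⟨fun hw => hw.1, fun hw => ⟨hw, splice n x w, fun i hi => ?_, fun i hi => ?_⟩⟩
  · exact splice_of_lt (h.trans (endVtx_eq_of_mem_cyl hw).symm) hi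
  · exact (splice_of_le x w hi).symm

end BratteliDiagram

/-- **Adamska–Bezuglyi–Karpel–Kwiatkowski.** If the path space `X_B̄` of a subdiagram
`B̄ ⊆ B` is thin (i.e. it is a null set for every ergodic tail-invariant probability
measure on `X_B`), then for every tail-invariant probability measure `μ̄` on `X_B̄` the
tail-invariant extension `μ̂` of `μ̄` to the saturation `X̂_B̄` is infinite. -/
theorem thin_subdiagram_extension_infinite
    (B : BratteliDiagram)
    (hCantor : ∀ x : B.PathSpace, ¬IsOpen ({x} : Set B.PathSpace))
    (Es : ∀ n : ℕ, Finset (B.E n)) (hEne : ∀ n, (Es n).Nonempty)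
    (hin : ∀ (n : ℕ), ∀ e ∈ Es (n + 1), ∃ e' ∈ Es n, B.rng n e' = B.src (n + 1) e)
    (hout : ∀ (n : ℕ), ∀ e ∈ Es n, ∃ e' ∈ Es (n + 1), B.src (n + 1) e' = B.rng n e)
    (hthin : ∀ μ : Measure B.PathSpace, IsProbabilityMeasure μ → B.TailInvariant μ →
      B.TailErgodic μ → μ (B.edgeSubPaths Es) = 0)
    (μbar : Measure B.PathSpace) (hprob : IsProbabilityMeasure μbar)
    (hsupp : μbar (B.edgeSubPaths Es)ᶜ = 0)
    (hinvbar : B.TailInvariantOn (B.edgeSubPaths Es) μbar)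
    (μhat : Measure B.PathSpace)
    (hinvhat : B.StrongTailInvariant μhat)
    (hsat : μhat (B.saturation (B.edgeSubPaths Es))ᶜ = 0)
    (hres : μhat.restrict (B.edgeSubPaths Es) = μbar) :
    μhat (B.saturation (B.edgeSubPaths Es)) = ⊤ := by
  by_contra hfin
  have hF : μhat (B.edgeSubPaths Es) = 1 := by
    rw [← Measure.restrict_apply_univ, hres, measure_univ]
  have huniv : μhat Set.univ ≠ ⊤ := by
    refine ne_top_of_le_ne_top hfin ?_
    calc μhat Set.univ ≤ μhat (B.saturation (B.edgeSubPaths Es)) +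
          μhat (B.saturation (B.edgeSubPaths Es))ᶜ := by
          rw [← Set.union_compl_self (B.saturation (B.edgeSubPaths Es))]
          exact measure_union_le _ _
      _ = μhat (B.saturation (B.edgeSubPaths Es)) := by rw [hsat, add_zero]
  have huniv₀ : μhat Set.univ ≠ 0 := fun h =>
    one_ne_zero (hF.symm.trans (measure_mono_null (Set.subset_univ _) h))
  have hν : B.TailInvariant (ProbabilityTheory.cond μhat Set.univ) := fun n x y h => by
    rw [ProbabilityTheory.cond_apply .univ, ProbabilityTheory.cond_apply .univ, Set.univ_inter,
      Set.univ_inter, hinvhat.tailInvariant n x y h]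
  obtain ⟨μ, hμinv, hμerg, hμF⟩ := BratteliDiagram.exists_tailErgodic_le
    (BratteliDiagram.isClosed_edgeSubPaths Es)
    ⟨_, ProbabilityTheory.cond_isProbabilityMeasure_of_finite huniv₀ huniv⟩ hν
  rw [hthin μ inferInstance hμinv hμerg, nonpos_iff_eq_zero] at hμF
  change ProbabilityTheory.cond μhat Set.univ _ = 0 at hμF
  rw [ProbabilityTheory.cond_apply .univ, Set.univ_inter, hF, mul_one] at hμF
  exact huniv (ENNReal.inv_eq_zero.1 hμF)
end

section
/- Every aperiodic substitution σ : A → A^+ is recognizable: for every x ∈ X_σ there exist a unique y ∈ X_σ and a unique i ∈ {0, …, |σ(y[0])| − 1} such that x = T_σ^i σ(y). -/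
/-- Iterates `σ^n(a)` of a substitution, as words. -/
def subIter {A : Type} (σ : A → List A) : ℕ → A → List A
  | 0, a => [a]
  | n + 1, a => (subIter σ n a).flatMap σ

/-- The language `L(σ)`: all words occurring as factors of some `σ^n(a)`. -/
def InLang {A : Type} (σ : A → List A) (w : List A) : Prop :=
  ∃ (n : ℕ) (a : A), w <:+: subIter σ n a

/-- Membership in the substitution subshift `X_σ`: every finite factor of `x`
belongs to the language of `σ`. -/
def MemSubShift {A : Type} (σ : A → List A) (x : ℤ → A) : Prop :=
  ∀ (k : ℤ) (l : ℕ), InLang σ (List.ofFn fun i : Fin l => x (k + (i : ℕ)))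

/-- `x = T_σ^i σ(y)`: there is a cut function `c : ℤ → ℤ` with `c 0 = -i`,
`c (k+1) = c k + |σ(y k)|`, such that the word of `x` starting at `c k` of length
`|σ(y k)|` equals `σ(y k)` for every `k`. -/
def IsSubstDecomp {A : Type} (σ : A → List A) (x y : ℤ → A) (i : ℕ) : Prop :=
  ∃ c : ℤ → ℤ, c 0 = -(i : ℤ) ∧
    (∀ k : ℤ, c (k + 1) = c k + (σ (y k)).length) ∧
    ∀ k : ℤ, σ (y k) = List.ofFn fun r : Fin (σ (y k)).length => x (c k + (r : ℕ))

/-- The word `w` occurs in the bi-infinite sequence `x` at position `p`. -/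
def OccursAt {C : Type} (x : ℤ → C) (p : ℤ) (w : List C) : Prop :=
  ∀ (r : ℕ) (h : r < w.length), x (p + r) = w[r]

namespace OccursAt

variable {C : Type} {x x' : ℤ → C} {p p' : ℤ} {v w : List C}

theorem append_iff :
    OccursAt x p (v ++ w) ↔ OccursAt x p v ∧ OccursAt x (p + v.length) w := by
  constructor
  · intro h
    refine ⟨fun r hr => ?_, fun r hr => ?_⟩
    · rw [h r (by rw [List.length_append]; omega), List.getElem_append_left hr]
    · have := h (v.length + r) (by rw [List.length_append]; omega)
      rw [List.getElem_append_right (by omega)] at this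
      simpa [add_assoc] using this
  · rintro ⟨h1, h2⟩ r hr
    rw [List.getElem_append]
    split_ifs with h
    · exact h1 r h
    · rw [← h2 (r - v.length) (by rw [List.length_append] at hr; omega)]
      congr 1
      omega

theorem congr_seq (h : OccursAt x p w) (hx : ∀ r : ℕ, r < w.length → x' (p' + r) = x (p + r)) :
    OccursAt x' p' w := fun r hr => by rw [hx r hr, h r hr]

theorem isPrefix (hv : OccursAt x p v) (hw : OccursAt x p w) (hl : v.length ≤ w.length) :
    v <+: w := by
  rw [List.prefix_iff_eq_take]
  refine List.ext_getElem (by simp [hl]) fun r h1 h2 => ?_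
  rw [List.getElem_take, ← hv r h1, ← hw r (by omega)]

theorem eq_ofFn_iff : w = List.ofFn (fun r : Fin w.length => x (p + (r : ℕ))) ↔ OccursAt x p w := by
  constructor
  · intro h r hr
    have : w[r] = (List.ofFn (fun r : Fin w.length => x (p + (r : ℕ))))[r]'(by simpa using hr) := by
      congr 1
    rw [this, List.getElem_ofFn]
  · intro h
    refine List.ext_getElem (by simp) fun r h1 h2 => ?_
    rw [List.getElem_ofFn, ← h r h1]

theorem ofFn (x : ℤ → C) (p : ℤ) (l : ℕ) :
    OccursAt x p (List.ofFn fun r : Fin l => x (p + (r : ℕ))) := fun r hr => by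
  rw [List.getElem_ofFn]

theorem reverse (h : OccursAt x p w) :
    OccursAt (fun m => x (-1 - m)) (-(p + w.length)) w.reverse := by
  intro r hr
  rw [List.length_reverse] at hr
  rw [List.getElem_reverse, ← h]
  dsimp only
  congr 1
  omega

end OccursAt

section Defect

/-- `P` is a set of cutting points of `x`, closed under passing to the next block `u d`. -/
def IsCutSet {C D : Type} (u : D → List C) (x : ℤ → C) (P : Set ℤ) : Prop :=
  ∀ p ∈ P, ∃ d, OccursAt x p (u d) ∧ p + (u d).length ∈ P

/-- The right-infinite word of `x` at `p` is a concatenation of blocks of `u`, the first of which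
is `u d`. -/
def StartsWith {C D : Type} (u : D → List C) (x : ℤ → C) (p : ℤ) (d : D) : Prop :=
  ∃ P, IsCutSet u x P ∧ OccursAt x p (u d) ∧ p + (u d).length ∈ P

/-- `u` factors through a free monoid whose rank is at least `k` less than the number of letters
of `D`. -/
def FactorsThrough {C D : Type} [Fintype D] (k : ℕ) (u : D → List C) : Prop :=
  ∃ (B : Type) (_ : Fintype B) (β : D → List B) (α : B → List C),
    Fintype.card B + k ≤ Fintype.card D ∧ (∀ d, β d ≠ []) ∧ (∀ b, α b ≠ []) ∧
      ∀ d, u d = (β d).flatMap α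

theorem flatMap_ne_nil {C D : Type} {u : D → List C} (hu : ∀ d, u d ≠ []) {w : List D}
    (hw : w ≠ []) : w.flatMap u ≠ [] := by
  cases w with
  | nil => exact absurd rfl hw
  | cons a w => simp [hu a]

theorem FactorsThrough.comp {C D D' : Type} [Fintype D] [Fintype D'] {k j m : ℕ} {u : D → List C}
    {u' : D' → List C} (h : FactorsThrough k u') (γ : D → List D') (hγ : ∀ d, γ d ≠ [])
    (hu : ∀ d, u d = (γ d).flatMap u')
    (hc : Fintype.card D' + j ≤ Fintype.card D) (hm : m ≤ k + j) : FactorsThrough m u := by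
  obtain ⟨B, _, β, α, h1, h2, h3, h4⟩ := h
  refine ⟨B, inferInstance, fun d => (γ d).flatMap β, α, by omega,
    fun d => flatMap_ne_nil h2 (hγ d), h3, fun d => ?_⟩
  rw [hu, List.flatMap_assoc]
  congr 1
  exact funext h4

theorem FactorsThrough.refl {C D : Type} [Fintype D] {u : D → List C} (hu : ∀ d, u d ≠ []) :
    FactorsThrough 0 u :=
  ⟨D, inferInstance, fun d => [d], u, le_rfl, by simp, hu, by simp⟩

theorem FactorsThrough.reverse {C D : Type} [Fintype D] {k : ℕ} {u : D → List C}
    (h : FactorsThrough k u) : FactorsThrough k fun d => (u d).reverse := by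
  obtain ⟨B, _, β, α, h1, h2, h3, h4⟩ := h
  refine ⟨B, inferInstance, fun d => (β d).reverse, fun b => (α b).reverse, h1, by simpa using h2,
    by simpa using h3, fun d => ?_⟩
  dsimp only
  rw [h4, List.reverse_flatMap]
  rfl

variable {C D : Type}

section Merge

variable [DecidableEq D] {u : D → List C} {d e : D}

/-- The identification of the letter `e` with the letter `d`. -/
def mergeLetter (d e : D) (hde : d ≠ e) (a : D) : {a // a ≠ e} :=
  if h : a = e then ⟨d, hde⟩ else ⟨a, h⟩

theorem apply_mergeLetter (hde : d ≠ e) (h : u d = u e) (a : D) :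
    u (mergeLetter d e hde a) = u a := by
  unfold mergeLetter
  split_ifs with ha
  · rw [ha, h]
  · rfl

theorem StartsWith.merge (hde : d ≠ e) (h : u d = u e) {x : ℤ → C} {p : ℤ} {a : D}
    (ha : StartsWith u x p a) :
    StartsWith (fun b : {a // a ≠ e} => u b) x p (mergeLetter d e hde a) := by
  obtain ⟨P, h1, h2, h3⟩ := ha
  refine ⟨P, fun p hp => ?_, ?_, ?_⟩
  · obtain ⟨b, hb, hb'⟩ := h1 p hp
    refine ⟨mergeLetter d e hde b, ?_⟩
    dsimp only
    rw [apply_mergeLetter hde h]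
    exact ⟨hb, hb'⟩
  · dsimp only
    rwa [apply_mergeLetter hde h]
  · dsimp only
    rwa [apply_mergeLetter hde h]

theorem FactorsThrough.merge [Fintype D] (hde : d ≠ e) (h : u d = u e) {k : ℕ}
    (hk : FactorsThrough k fun b : {a // a ≠ e} => u b) : FactorsThrough (k + 1) u := by
  refine hk.comp (j := 1) (fun a => [mergeLetter d e hde a]) (by simp)
    (fun a => by simp [apply_mergeLetter hde h]) ?_ le_rfl
  have : 0 < Fintype.card D := Fintype.card_pos_iff.2 ⟨d⟩
  rw [Fintype.card_subtype_compl, Fintype.card_subtype_eq]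
  omega

end Merge

section Split

variable [DecidableEq D] {u : D → List C} {d e : D} {v : List C} {x : ℤ → C} {p : ℤ}

theorem IsCutSet.split (hde : d ≠ e) (h : u e = u d ++ v) {P : Set ℤ} (hP : IsCutSet u x P) :
    IsCutSet (Function.update u e v) x {p | p ∈ P ∨ (OccursAt x p v ∧ p + v.length ∈ P)} := by
  rintro p (hp | ⟨hp, hp'⟩)
  · obtain ⟨a, ha, ha'⟩ := hP p hp
    by_cases hae : a = e
    · subst hae
      rw [h, OccursAt.append_iff] at ha
      refine ⟨d, ?_⟩
      rw [Function.update_of_ne hde]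
      refine ⟨ha.1, Or.inr ⟨ha.2, ?_⟩⟩
      rw [h, List.length_append] at ha'
      push_cast at ha'
      rwa [add_assoc]
    · refine ⟨a, ?_⟩
      rw [Function.update_of_ne hae]
      exact ⟨ha, Or.inl ha'⟩
  · refine ⟨e, ?_⟩
    rw [Function.update_self]
    exact ⟨hp, Or.inl hp'⟩

theorem StartsWith.split_of_ne (hde : d ≠ e) (h : u e = u d ++ v) {a : D} (hae : a ≠ e)
    (ha : StartsWith u x p a) : StartsWith (Function.update u e v) x p a := by
  obtain ⟨P, h1, h2, h3⟩ := ha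
  refine ⟨_, h1.split hde h, ?_⟩
  rw [Function.update_of_ne hae]
  exact ⟨h2, Or.inl h3⟩

theorem StartsWith.split_self (hde : d ≠ e) (h : u e = u d ++ v)
    (ha : StartsWith u x p e) : StartsWith (Function.update u e v) x p d := by
  obtain ⟨P, h1, h2, h3⟩ := ha
  refine ⟨_, h1.split hde h, ?_⟩
  rw [h, OccursAt.append_iff] at h2
  rw [h, List.length_append] at h3
  push_cast at h3
  rw [Function.update_of_ne hde]
  refine ⟨h2.1, Or.inr ⟨h2.2, ?_⟩⟩
  rwa [add_assoc]

theorem StartsWith.split (hde : d ≠ e) (h : u e = u d ++ v) {a : D}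
    (ha : StartsWith u x p a) :
    StartsWith (Function.update u e v) x p (if a = e then d else a) := by
  split_ifs with hae
  · subst hae
    exact ha.split_self hde h
  · exact ha.split_of_ne hde h hae

theorem StartsWith.split_tail_self (hde : d ≠ e) (h : u e = u d ++ v)
    (ha : StartsWith u x p e) :
    StartsWith (Function.update u e v) x (p + (u d).length) e := by
  obtain ⟨P, h1, h2, h3⟩ := ha
  refine ⟨_, h1.split hde h, ?_⟩
  rw [h, OccursAt.append_iff] at h2
  rw [h, List.length_append] at h3
  push_cast at h3
  rw [Function.update_self]
  refine ⟨h2.2, Or.inl ?_⟩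
  rwa [add_assoc]

theorem StartsWith.split_tail (hde : d ≠ e) (h : u e = u d ++ v)
    (ha : StartsWith u x p d) :
    ∃ b, b ≠ e ∧ StartsWith (Function.update u e v) x (p + (u d).length) b := by
  obtain ⟨P, h1, h2, h3⟩ := ha
  obtain ⟨b, hb, hb'⟩ := h1 _ h3
  have hs : StartsWith u x (p + (u d).length) b := ⟨P, h1, hb, hb'⟩
  refine ⟨_, ?_, hs.split hde h⟩
  split_ifs with hbe
  · exact hde
  · exact hbe

theorem FactorsThrough.split [Fintype D] (hde : d ≠ e) (h : u e = u d ++ v) {k : ℕ}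
    (hk : FactorsThrough k (Function.update u e v)) : FactorsThrough k u := by
  refine hk.comp (j := 0) (fun a => if a = e then [d, e] else [a])
    (fun a => by split_ifs <;> simp) (fun a => ?_) le_rfl le_rfl
  split_ifs with hae
  · subst hae
    simp [Function.update_of_ne hde, h]
  · simp [Function.update_of_ne hae]

theorem sum_length_update_lt [Fintype D] (hu : u d ≠ []) (h : u e = u d ++ v) :
    ∑ a, (Function.update u e v a).length < ∑ a, (u a).length := by
  refine Finset.sum_lt_sum (fun a _ => ?_) ⟨e, Finset.mem_univ e, ?_⟩
  · by_cases hae : a = e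
    · subst hae
      simp [h]
    · simp [Function.update_of_ne hae]
  · have := List.length_pos_iff.2 hu
    rw [Function.update_self, h, List.length_append]
    omega

theorem update_ne_nil (hu : ∀ a, u a ≠ []) (hv : v ≠ []) (a : D) :
    Function.update u e v a ≠ [] := by
  by_cases hae : a = e
  · subst hae
    simpa
  · simpa [Function.update_of_ne hae] using hu a

end Split

/-- The defect theorem for one relation between right-infinite words. -/
theorem factorsThrough_one [Fintype D] {u : D → List C} (hu : ∀ d, u d ≠ []) {x : ℤ → C} {p : ℤ}
    {d e : D} (hde : d ≠ e) (hd : StartsWith u x p d) (he : StartsWith u x p e) :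
    FactorsThrough 1 u := by
  classical
  induction hn : ∑ a, (u a).length using Nat.strong_induction_on generalizing u p d e with
  | _ n ih =>
  wlog hl : (u d).length ≤ (u e).length generalizing d e
  · exact this hde.symm he hd (by omega)
  obtain ⟨v, hv⟩ : u d <+: u e := hd.choose_spec.2.1.isPrefix he.choose_spec.2.1 hl
  by_cases hv0 : v = []
  · subst hv0
    rw [List.append_nil] at hv
    exact (FactorsThrough.refl fun b : {a // a ≠ e} => hu b).merge hde hv
  · obtain ⟨b, hbe, hb⟩ := hd.split_tail hde hv.symm
    exact (ih _ (hn ▸ sum_length_update_lt (hu d) hv.symm) (update_ne_nil hu hv0) hbe hb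
      (he.split_tail_self hde hv.symm) rfl).split hde hv.symm

/-- The defect theorem for two independent relations between right-infinite words. -/
theorem factorsThrough_two [Fintype D] {u : D → List C} (hu : ∀ d, u d ≠ []) {x : ℤ → C}
    {p p' : ℤ} {d e d' e' : D} (hde : d ≠ e) (hd : StartsWith u x p d) (he : StartsWith u x p e)
    (hde' : d' ≠ e') (hd' : StartsWith u x p' d') (he' : StartsWith u x p' e')
    (h1 : ¬(d = d' ∧ e = e')) (h2 : ¬(d = e' ∧ e = d')) :
    FactorsThrough 2 u := by
  classical
  induction hn : ∑ a, (u a).length using Nat.strong_induction_on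
    generalizing u p p' d e d' e' with
  | _ n ih =>
  wlog hl : (u d).length ≤ (u e).length generalizing d e
  · exact this hde.symm he hd (by tauto) (by tauto) (by omega)
  obtain ⟨v, hv⟩ : u d <+: u e := hd.choose_spec.2.1.isPrefix he.choose_spec.2.1 hl
  by_cases hv0 : v = []
  · subst hv0
    rw [List.append_nil] at hv
    refine FactorsThrough.merge hde hv (factorsThrough_one (fun b => hu b) ?_
      (hd'.merge hde hv) (he'.merge hde hv))
    simp only [mergeLetter, ne_eq]
    grind
  · obtain ⟨b, hbe, hb⟩ := hd.split_tail hde hv.symm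
    refine (ih _ (hn ▸ sum_length_update_lt (hu d) hv.symm) (update_ne_nil hu hv0) hbe hb
      (he.split_tail_self hde hv.symm) ?_ (hd'.split hde hv.symm) (he'.split hde hv.symm)
      ?_ ?_ rfl).split hde hv.symm
    all_goals grind

end Defect

section Factorization

/-- The bi-infinite sequence `x` is the concatenation of the blocks `σ (y k)`, the `k`-th of which
starts at position `c k`. -/
structure IsFactorization {A C : Type} (σ : A → List C) (x : ℤ → C) (y : ℤ → A) (c : ℤ → ℤ) :
    Prop where
  step : ∀ k, c (k + 1) = c k + (σ (y k)).length
  occursAt : ∀ k, OccursAt x (c k) (σ (y k))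

theorem exists_eq_add_of_step (f : ℤ → ℤ) (b : ℤ) :
    ∃ c : ℤ → ℤ, c 0 = b ∧ ∀ k, c (k + 1) = c k + f k := by
  refine ⟨fun k => b + ∑ i ∈ Finset.range k.toNat, f i -
    ∑ i ∈ Finset.range (-k).toNat, f (-1 - i), by simp, fun k => ?_⟩
  rcases le_or_gt 0 k with hk | hk
  · obtain ⟨n, rfl⟩ := Int.eq_ofNat_of_zero_le hk
    have h1 : ((n : ℤ) + 1).toNat = n + 1 := by omega
    have h2 : (-((n : ℤ) + 1)).toNat = 0 := by omega
    have h3 : (-(n : ℤ)).toNat = 0 := by omega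
    have h4 : (n : ℤ).toNat = n := by omega
    simp only [h1, h2, h3, h4, Finset.sum_range_succ]
    simp only [Finset.range_zero, Finset.sum_empty]
    ring
  · obtain ⟨n, rfl⟩ : ∃ n : ℕ, k = -1 - n := ⟨(-1 - k).toNat, by omega⟩
    have h1 : (-1 - (n : ℤ) + 1).toNat = 0 := by omega
    have h2 : (-(-1 - (n : ℤ) + 1)).toNat = n := by omega
    have h3 : (-(-1 - (n : ℤ))).toNat = n + 1 := by omega
    have h4 : (-1 - (n : ℤ)).toNat = 0 := by omega
    simp only [h1, h2, h3, h4, Finset.sum_range_succ]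
    simp only [Finset.range_zero, Finset.sum_empty]
    ring

theorem eq_of_step {f c c' : ℤ → ℤ} (hc : ∀ k, c (k + 1) = c k + f k)
    (hc' : ∀ k, c' (k + 1) = c' k + f k) {m : ℤ} (hm : c m = c' m) : c = c' := by
  funext k
  induction k using Int.inductionOn' (b := m) with
  | zero => exact hm
  | succ k _ ih => rw [hc, hc', ih]
  | pred k _ ih =>
    have h1 := hc (k - 1)
    have h2 := hc' (k - 1)
    rw [sub_add_cancel] at h1 h2
    omega

theorem exists_le_lt_of_strictMono {c : ℤ → ℤ} (hc : StrictMono c) (m : ℤ) :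
    ∃ k, c k ≤ m ∧ m < c (k + 1) := by
  have hlow : ∀ n : ℕ, c (-n) ≤ c 0 - n := by
    intro n
    induction n with
    | zero => simp
    | succ n ih =>
      have : c (-((n + 1 : ℕ) : ℤ)) < c (-n) := hc (by push_cast; omega)
      push_cast at *
      omega
  have hhigh : ∀ n : ℕ, c 0 + n ≤ c n := by
    intro n
    induction n with
    | zero => simp
    | succ n ih =>
      have : c n < c ((n + 1 : ℕ) : ℤ) := hc (by push_cast; omega)
      push_cast at *
      omega
  obtain ⟨k, hk, hmax⟩ := Int.exists_greatest_of_bdd (P := fun k => c k ≤ m)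
    ⟨(m - c 0).toNat, fun z hz => by
      by_contra! h
      have h1 := hc h
      have h2 := hhigh (m - c 0).toNat
      omega⟩
    ⟨-((c 0 - m).toNat : ℤ), by
      have := hlow (c 0 - m).toNat
      omega⟩
  refine ⟨k, hk, ?_⟩
  by_contra! h
  have := hmax _ h
  omega

namespace IsFactorization

variable {A B C : Type} {σ : A → List C} {α : B → List C} {β : A → List B} {x x' : ℤ → C}
  {y : ℤ → A} {z : ℤ → B} {c c' d e : ℤ → ℤ}

theorem strictMono (hσ : ∀ a, σ a ≠ []) (h : IsFactorization σ x y c) : StrictMono c := by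
  refine strictMono_int_of_lt_succ fun k => ?_
  have := List.length_pos_iff.2 (hσ (y k))
  rw [h.step k]
  omega

theorem comp_aux (h : IsFactorization α x z c) {w : List B} {p : ℤ} (hw : OccursAt z p w) :
    c (p + w.length) = c p + (w.flatMap α).length ∧ OccursAt x (c p) (w.flatMap α) := by
  induction w generalizing p with
  | nil => exact ⟨by simp, fun r hr => absurd hr (by simp)⟩
  | cons b w ih =>
    rw [← List.singleton_append, OccursAt.append_iff] at hw
    have hb : z p = b := by simpa using hw.1 0 (by simp)
    obtain ⟨h1, h2⟩ := ih hw.2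
    have h3 := h.step p
    have h4 := h.occursAt p
    rw [hb] at h3 h4
    rw [List.flatMap_cons, OccursAt.append_iff, ← h3]
    rw [List.length_singleton, Nat.cast_one] at h1 h2
    refine ⟨?_, h4, h2⟩
    rw [List.length_cons]
    push_cast
    rw [List.length_append]
    push_cast
    rw [← add_assoc (c p), ← h3, ← h1]
    congr 1
    ring

theorem comp (hβ : IsFactorization β z y d) (hα : IsFactorization α x z c)
    (hσ : ∀ a, σ a = (β a).flatMap α) : IsFactorization σ x y (c ∘ d) where
  step k := by
    rw [Function.comp_apply, hβ.step, (hα.comp_aux (hβ.occursAt k)).1, hσ]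
    rfl
  occursAt k := by
    rw [hσ]
    exact (hα.comp_aux (hβ.occursAt k)).2

theorem eq_of_apply_eq (h : IsFactorization σ x y c) (h' : IsFactorization σ x' y c') {m : ℤ}
    (hm : c m = c' m) : c = c' :=
  eq_of_step h.step h'.step hm

theorem seq_eq (hσ : ∀ a, σ a ≠ []) (h : IsFactorization σ x y c) (h' : IsFactorization σ x' y c) :
    x = x' := by
  funext m
  obtain ⟨k, hk, hk'⟩ := exists_le_lt_of_strictMono (h.strictMono hσ) m
  rw [h.step] at hk'
  have h1 := h.occursAt k (m - c k).toNat (by omega)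
  have h2 := h'.occursAt k (m - c k).toNat (by omega)
  rw [← h2] at h1
  have h3 : c k + ((m - c k).toNat : ℤ) = m := by omega
  rwa [h3] at h1

theorem exists_of_seq (hσ : ∀ a, σ a ≠ []) (y : ℤ → A) (b : ℤ) :
    ∃ x c, IsFactorization σ x y c ∧ c 0 = b := by
  obtain ⟨c, hc0, hc⟩ := exists_eq_add_of_step (fun k => (σ (y k)).length) b
  have hmono : StrictMono c := strictMono_int_of_lt_succ fun k => by
    have := List.length_pos_iff.2 (hσ (y k))
    rw [hc k]
    omega
  choose i hi hi' using exists_le_lt_of_strictMono hmono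
  have hlt : ∀ m, (m - c (i m)).toNat < (σ (y (i m))).length := fun m => by
    have h1 := hi m
    have h2 := hi' m
    rw [hc] at h2
    omega
  refine ⟨fun m => (σ (y (i m)))[(m - c (i m)).toNat]'(hlt m), c, ⟨hc, fun k r hr => ?_⟩, hc0⟩
  have hik : i (c k + r) = k := by
    have h1 := hi (c k + r)
    have h2 := hi' (c k + r)
    have h3 : c k + r < c (k + 1) := by rw [hc]; omega
    have h4 := hmono.lt_iff_lt.1 (h1.trans_lt h3)
    have h5 := hmono.lt_iff_lt.1 ((show c k ≤ c k + r by omega).trans_lt h2)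
    omega
  have hr' : (c k + r - c k).toNat = r := by omega
  simp only [hik, hr']

theorem shift (h : IsFactorization σ x y c) (m : ℤ) :
    IsFactorization σ x (fun k => y (k + m)) (fun k => c (k + m)) where
  step k := by rw [← h.step, add_right_comm]
  occursAt k := h.occursAt (k + m)

theorem shift_seq (h : IsFactorization σ x y c) (m : ℤ) :
    IsFactorization σ (fun k => x (k + m)) y (fun k => c k - m) where
  step k := by rw [h.step, add_sub_right_comm]
  occursAt k := (h.occursAt k).congr_seq fun r _ => by congr 1; ring

theorem reverse (h : IsFactorization σ x y c) :
    IsFactorization (fun a => (σ a).reverse) (fun m => x (-1 - m)) (fun k => y (-1 - k))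
      (fun k => -c (-k)) where
  step k := by
    have := h.step (-1 - k)
    rw [show -1 - k + 1 = -k by ring] at this
    rw [List.length_reverse, this, show -(k + 1) = -1 - k by ring]
    ring
  occursAt k := by
    have := (h.occursAt (-1 - k)).reverse
    rwa [← h.step, show -1 - k + 1 = -k by ring] at this

theorem exists_decomp (hα0 : ∀ b, α b ≠ []) (hβ0 : ∀ a, β a ≠ [])
    (hσ : ∀ a, σ a = (β a).flatMap α) (h : IsFactorization σ x y e) :
    ∃ z d c, IsFactorization β z y d ∧ IsFactorization α x z c ∧ e = c ∘ d := by
  obtain ⟨z, d, hz, hd⟩ := exists_of_seq hβ0 y 0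
  obtain ⟨x', c, hx', hc⟩ := exists_of_seq hα0 z (e 0)
  have h' := hz.comp hx' hσ
  have he : e = c ∘ d := h.eq_of_apply_eq h' (m := 0) (by simp [hd, hc])
  subst he
  have := h.seq_eq (fun a => hσ a ▸ flatMap_ne_nil hα0 (hβ0 a)) h'
  subst this
  exact ⟨z, d, c, hz, hx', rfl⟩

theorem isCutSet (h : IsFactorization σ x y c) : IsCutSet σ x (Set.range c) := by
  rintro _ ⟨k, rfl⟩
  exact ⟨y k, h.occursAt k, k + 1, h.step k⟩

theorem startsWith (h : IsFactorization σ x y c) (k : ℤ) : StartsWith σ x (c k) (y k) :=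
  ⟨_, h.isCutSet, h.occursAt k, k + 1, h.step k⟩

end IsFactorization

end Factorization

section Elementary

variable {A C : Type} [Fintype A] {u : A → List C} {x : ℤ → C}

theorem FactorsThrough.of_option {w : List C}
    (h : FactorsThrough 2 fun o : Option A => o.elim w u) : FactorsThrough 1 u := by
  obtain ⟨B, _, β, α, h1, h2, h3, h4⟩ := h
  rw [Fintype.card_option] at h1
  exact ⟨B, inferInstance, fun a => β (some a), α, by omega, fun a => h2 _, h3, fun a => h4 (some a)⟩

/-- If two cutting sets without a common point overlap in the same way at two places, then the
sequence continues to the right in the same way at these two places. -/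
theorem eq_of_overlap (hu : ∀ a, u a ≠ []) (hE : ¬FactorsThrough 1 u) (n : ℕ) {P Q : Set ℤ}
    (hP : IsCutSet u x P) (hQ : IsCutSet u x Q) (hPQ : Disjoint P Q) {p p' : ℤ} {t : ℕ}
    (hp : p ∈ P) (hp' : p' ∈ P) (hq : p + t ∈ Q) (hq' : p' + t ∈ Q) (ht : 0 < t)
    (hx : ∀ r : ℕ, r < t → x (p + r) = x (p' + r)) : x (p + n) = x (p' + n) := by
  induction n using Nat.strong_induction_on generalizing P Q p p' t with
  | _ n ih =>
  by_cases hnt : n < t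
  · exact hx n hnt
  obtain ⟨a, ha, haP⟩ := hP p hp
  obtain ⟨b, hb, hbP⟩ := hP p' hp'
  have hab : a = b := by
    by_contra hab
    refine hE (FactorsThrough.of_option (w := List.ofFn fun r : Fin t => x (p + (r : ℕ))) ?_)
    have hcut : ∀ {R : Set ℤ}, IsCutSet u x R → IsCutSet (fun o : Option A =>
        o.elim (List.ofFn fun r : Fin t => x (p + (r : ℕ))) u) x R := fun hR m hm => by
      obtain ⟨a, ha⟩ := hR m hm
      exact ⟨some a, ha⟩
    have hw := OccursAt.ofFn x p t
    refine factorsThrough_two (x := x) (p := p) (d := none) (e := some a) (p' := p') (d' := none)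
      (e' := some b) ?_ (by simp) ⟨Q, hcut hQ, hw, by simpa using hq⟩ ⟨P, hcut hP, ha, haP⟩
      (by simp) ⟨Q, hcut hQ, ?_, by simpa using hq'⟩ ⟨P, hcut hP, hb, hbP⟩ (by simpa using hab)
      (by simp)
    · rintro (_ | o)
      · simpa [← List.length_pos_iff] using ht.ne'
      · exact hu o
    · exact hw.congr_seq fun r hr => (hx r (by simpa using hr)).symm
  subst hab
  have hpos := List.length_pos_iff.2 (hu a)
  rcases lt_trichotomy (u a).length t with h | h | h
  · have := ih (n - (u a).length) (by omega) hP hQ hPQ (t := t - (u a).length) haP hbP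
      (by convert hq using 1; omega) (by convert hq' using 1; omega) (by omega) fun r hr => by
        have := hx ((u a).length + r) (by omega)
        push_cast at this
        rwa [← add_assoc, ← add_assoc] at this
    convert this using 2 <;> omega
  · exact (Set.disjoint_left.1 hPQ haP (by rwa [h])).elim
  · have := ih (n - t) (by omega) hQ hP hPQ.symm (t := (u a).length - t) hq hq'
      (by convert haP using 1; omega) (by convert hbP using 1; omega) (by omega) fun r hr => by
        have h1 := ha (t + r) (by omega)
        have h2 := hb (t + r) (by omega)
        rw [← h2] at h1
        push_cast at h1
        rwa [← add_assoc, ← add_assoc] at h1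
    convert this using 2 <;> omega

theorem eq_right_of_common_cut (hu : ∀ a, u a ≠ []) (hE : ¬FactorsThrough 1 u)
    {y y' : ℤ → A} {c c' : ℤ → ℤ} (h : IsFactorization u x y c) (h' : IsFactorization u x y' c')
    {k j : ℤ} (hkj : c k = c' j) (n : ℕ) : c (k + n) = c' (j + n) ∧ y (k + n) = y' (j + n) := by
  have key : ∀ {k j : ℤ}, c k = c' j → y k = y' j := fun {k j} hkj => by
    by_contra hne
    exact hE (factorsThrough_one hu hne (h.startsWith k) (hkj ▸ h'.startsWith j))
  induction n with
  | zero => simpa using ⟨hkj, key hkj⟩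
  | succ n ih =>
    have : c (k + (n + 1 : ℕ)) = c' (j + (n + 1 : ℕ)) := by
      push_cast
      rw [← add_assoc, ← add_assoc, h.step, h'.step, ih.1, ih.2]
    exact ⟨this, key this⟩

theorem not_factorsThrough_reverse {k : ℕ} (hE : ¬FactorsThrough k u) :
    ¬FactorsThrough k fun a => (u a).reverse := fun h => hE (by simpa using h.reverse)

theorem eq_of_common_cut (hu : ∀ a, u a ≠ []) (hE : ¬FactorsThrough 1 u)
    {y y' : ℤ → A} {c c' : ℤ → ℤ} (h : IsFactorization u x y c) (h' : IsFactorization u x y' c')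
    {k j : ℤ} (hkj : c k = c' j) (m : ℤ) : c (k + m) = c' (j + m) ∧ y (k + m) = y' (j + m) := by
  rcases le_or_gt 0 m with hm | hm
  · obtain ⟨n, rfl⟩ := Int.eq_ofNat_of_zero_le hm
    exact eq_right_of_common_cut hu hE h h' hkj n
  · have := fun n => eq_right_of_common_cut (by simpa using hu) (not_factorsThrough_reverse hE)
      h.reverse h'.reverse (k := -k) (j := -j) (by simpa using hkj) n
    have h1 := (this (-m).toNat).1
    have h2 := (this (-1 - m).toNat).2
    rw [neg_inj, show -(-k + ((-m).toNat : ℤ)) = k + m by omega,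
      show -(-j + ((-m).toNat : ℤ)) = j + m by omega] at h1
    rw [show -1 - (-k + ((-1 - m).toNat : ℤ)) = k + m by omega,
      show -1 - (-j + ((-1 - m).toNat : ℤ)) = j + m by omega] at h2
    exact ⟨h1, h2⟩

end Elementary

section Recognizable

/-- A bi-infinite sequence without period that has two different factorizations over the blocks of
`u` forces `u` to factor through a smaller alphabet. -/
theorem exists_shift_of_not_factorsThrough {A C : Type} [Fintype A] [Finite C] {u : A → List C}
    {x : ℤ → C} (hu : ∀ a, u a ≠ []) (hE : ¬FactorsThrough 1 u)
    (hper : ∀ p : ℕ, 0 < p → ¬∀ i : ℤ, x (i + p) = x i)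
    {y y' : ℤ → A} {c c' : ℤ → ℤ} (h : IsFactorization u x y c) (h' : IsFactorization u x y' c') :
    ∃ m, ∀ k, c' k = c (k + m) ∧ y' k = y (k + m) := by
  by_cases hkj : ∃ k j, c k = c' j
  · obtain ⟨k, j, hkj⟩ := hkj
    refine ⟨k - j, fun i => ?_⟩
    have := eq_of_common_cut hu hE h h' hkj (i - j)
    rw [show k + (i - j) = i + (k - j) by ring, add_sub_cancel] at this
    exact ⟨this.1.symm, this.2.symm⟩
  exfalso
  push Not at hkj
  have hdisj : Disjoint (Set.range c) (Set.range c') := by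
    rw [Set.disjoint_left]
    rintro _ ⟨k, rfl⟩ ⟨j, hj⟩
    exact hkj k j hj.symm
  obtain ⟨M, hM⟩ : ∃ M, ∀ a, (u a).length ≤ M :=
    ⟨∑ a, (u a).length, fun a => Finset.single_le_sum (f := fun a => (u a).length)
      (fun _ _ => Nat.zero_le _) (Finset.mem_univ a)⟩
  have hq : ∀ k : ℕ, ∃ t : ℕ, 0 < t ∧ t ≤ M ∧ c k + t ∈ Set.range c' := fun k => by
    obtain ⟨j, hj, hj'⟩ := exists_le_lt_of_strictMono (h'.strictMono hu) (c k)
    have h1 := h'.step j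
    have h2 := hM (y' j)
    exact ⟨(c' (j + 1) - c k).toNat, by omega, by omega, j + 1, by omega⟩
  choose t ht htM htQ using hq
  obtain ⟨k, k', hne, hkk'⟩ := Finite.exists_ne_map_eq_of_infinite
    fun k : ℕ => ((⟨t k, Nat.lt_succ_of_le (htM k)⟩, fun r => x (c k + (r : ℕ))) :
      Fin (M + 1) × (Fin M → C))
  wlog hlt : k < k' generalizing k k'
  · exact this k' k hne.symm hkk'.symm (by omega)
  obtain ⟨h1, h2⟩ := Prod.mk.inj hkk'
  rw [Fin.mk.injEq] at h1
  have hx : ∀ r : ℕ, r < t k → x (c k + r) = x (c k' + r) := fun r hr =>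
    congrFun h2 ⟨r, hr.trans_le (htM k)⟩
  have hcc : c k < c k' := h.strictMono hu (by exact_mod_cast hlt)
  obtain ⟨j, hj⟩ := htQ k
  obtain ⟨j', hj'⟩ := htQ k'
  have hright := fun n => eq_of_overlap hu hE n h.isCutSet h'.isCutSet hdisj ⟨_, rfl⟩ ⟨_, rfl⟩
    (htQ k) (h1 ▸ htQ k') (ht k) hx
  have hleft := fun n => eq_of_overlap (p := -c' j) (p' := -c' j') (t := t k) (by simpa using hu)
    (not_factorsThrough_reverse hE) n h'.reverse.isCutSet h.reverse.isCutSet (by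
      rw [Set.disjoint_left]
      rintro _ ⟨a, rfl⟩ ⟨b, hb⟩
      exact hkj _ _ (neg_inj.1 hb)) ⟨-j, by simp⟩ ⟨-j', by simp⟩
    ⟨-k, by simp only [neg_neg]; omega⟩ ⟨-k', by simp only [neg_neg]; omega⟩ (ht k) fun r hr => by
      have := hx (t k - 1 - r) (by omega)
      convert this using 2 <;> omega
  refine hper (c k' - c k).toNat (by omega) fun i => ?_
  rcases le_or_gt (c k) i with hi | hi
  · have := hright (i - c k).toNat
    symm
    convert this using 2 <;> omega
  · have := hleft (c' j - 1 - i).toNat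
    symm
    convert this using 2 <;> omega

/-- Any two factorizations of a sequence over the blocks of `σ` by elements of `X` agree up to a
shift of the indices. -/
def IsRecognizableOn {A C : Type} (σ : A → List C) (X : Set (ℤ → A)) : Prop :=
  ∀ ⦃x : ℤ → C⦄ ⦃y y' : ℤ → A⦄ ⦃c c' : ℤ → ℤ⦄, y ∈ X → y' ∈ X → IsFactorization σ x y c →
    IsFactorization σ x y' c' → ∃ m, ∀ k, c' k = c (k + m) ∧ y' k = y (k + m)

/-- A set of sequences without periodic points that is mapped to itself by `σ`, and all elements of
which are, up to a shift, images under `σ` of elements of the set. -/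
structure IsAperiodicFor {A : Type} (σ : A → List A) (X : Set (ℤ → A)) : Prop where
  map_mem : ∀ ⦃y⦄, y ∈ X → ∀ ⦃x c⦄, IsFactorization σ x y c → x ∈ X
  exists_preimage : ∀ ⦃x⦄, x ∈ X → ∃ y ∈ X, ∃ c, IsFactorization σ x y c
  not_periodic : ∀ ⦃x⦄, x ∈ X → ∀ p : ℕ, 0 < p → ¬∀ i : ℤ, x (i + p) = x i

section Conjugate

variable {A B : Type} {σ : A → List A} {α : B → List A} {β : A → List B} {X : Set (ℤ → A)}

/-- All the sequences which are images under `β` of elements of `X`, up to a shift. -/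
def imageSet (β : A → List B) (X : Set (ℤ → A)) : Set (ℤ → B) :=
  {z | ∃ x ∈ X, ∃ d, IsFactorization β z x d}

theorem IsAperiodicFor.imageSet (hX : IsAperiodicFor σ X) (hα : ∀ b, α b ≠ [])
    (hβ : ∀ a, β a ≠ []) (hσ : ∀ a, σ a = (β a).flatMap α) :
    IsAperiodicFor (fun b => (α b).flatMap β) (imageSet β X) where
  map_mem := by
    rintro z ⟨x, hx, d, hd⟩ w c hc
    obtain ⟨v, d₁, c₁, hv, hw, -⟩ := hc.exists_decomp hβ hα fun _ => rfl
    exact ⟨v, hX.map_mem hx (hd.comp hv hσ), _, hw⟩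
  exists_preimage := by
    rintro z ⟨x, hx, d, hd⟩
    obtain ⟨y, hy, e, he⟩ := hX.exists_preimage hx
    obtain ⟨w, d', c', hw, hx', -⟩ := he.exists_decomp hα hβ hσ
    exact ⟨w, ⟨y, hy, d', hw⟩, _, hx'.comp hd fun _ => rfl⟩
  not_periodic := by
    rintro z ⟨x, hx, d, hd⟩ p hp hper
    obtain ⟨v, c, hv, -⟩ := IsFactorization.exists_of_seq hα z 0
    have hmono := hv.strictMono hα
    have hlt : c 0 < c p := hmono (by exact_mod_cast hp)
    have h1 := (hv.shift p).shift_seq (c p - c 0)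
    rw [show (fun k => z (k + p)) = z from funext hper] at h1
    have h2 : c = fun k => c (k + p) - (c p - c 0) := hv.eq_of_apply_eq h1 (m := 0) (by simp)
    rw [← h2] at h1
    have h3 := h1.seq_eq hα hv
    refine hX.not_periodic (hX.map_mem hx (hd.comp hv hσ)) (c p - c 0).toNat (by omega) fun i => ?_
    rw [Int.toNat_of_nonneg (by omega)]
    exact congrFun h3 i

theorem isRecognizableOn_left (hβ : ∀ a, β a ≠ [])
    (h : IsRecognizableOn (fun b => (α b).flatMap β) (imageSet β X)) :
    IsRecognizableOn α (imageSet β X) := by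
  intro x z z' c c' hz hz' hc hc'
  obtain ⟨w, d, hw, -⟩ := IsFactorization.exists_of_seq hβ x 0
  obtain ⟨m, hm⟩ := h hz hz' (hc.comp hw fun _ => rfl) (hc'.comp hw fun _ => rfl)
  exact ⟨m, fun k => ⟨(hw.strictMono hβ).injective (hm k).1, (hm k).2⟩⟩

theorem isRecognizableOn_right (hX : IsAperiodicFor σ X) (hα : ∀ b, α b ≠ [])
    (hβ : ∀ a, β a ≠ []) (hσ : ∀ a, σ a = (β a).flatMap α)
    (h : IsRecognizableOn (fun b => (α b).flatMap β) (imageSet β X)) :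
    IsRecognizableOn β X := by
  intro w x x' d d' hx hx' hd hd'
  obtain ⟨y, hy, e, he⟩ := hX.exists_preimage hx
  obtain ⟨y', hy', e', he'⟩ := hX.exists_preimage hx'
  obtain ⟨z, f, c, hz, hc, -⟩ := he.exists_decomp hα hβ hσ
  obtain ⟨z', f', c', hz', hc', -⟩ := he'.exists_decomp hα hβ hσ
  obtain ⟨m, hm⟩ := h ⟨y, hy, f, hz⟩ ⟨y', hy', f', hz'⟩ (hc.comp hd fun _ => rfl)
    (hc'.comp hd' fun _ => rfl)
  have h1 := (hc.shift m).shift_seq (c m - c' 0)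
  rw [← show z' = fun k => z (k + m) from funext fun k => (hm k).2] at h1
  have h2 := h1.eq_of_apply_eq hc' (m := 0) (by simp)
  rw [h2] at h1
  have h3 := h1.seq_eq hα hc'
  have h4 := hd.shift (c m - c' 0)
  rw [h3] at h4
  have h5 := h4.eq_of_apply_eq hd' (m := c' 0) (by simpa using (hm 0).1.symm)
  exact ⟨c m - c' 0, fun k => ⟨(congrFun h5 k).symm, (congrFun h3 k).symm⟩⟩

theorem IsRecognizableOn.comp (hα : ∀ b, α b ≠ []) (hβ : ∀ a, β a ≠ [])
    (hσ : ∀ a, σ a = (β a).flatMap α) (h1 : IsRecognizableOn α (imageSet β X))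
    (h2 : IsRecognizableOn β X) : IsRecognizableOn σ X := by
  intro x y y' e e' hy hy' he he'
  obtain ⟨z, d, c, hz, hc, rfl⟩ := he.exists_decomp hα hβ hσ
  obtain ⟨z', d', c', hz', hc', rfl⟩ := he'.exists_decomp hα hβ hσ
  obtain ⟨m, hm⟩ := h1 ⟨y, hy, d, hz⟩ ⟨y', hy', d', hz'⟩ hc hc'
  have h3 := hz'.shift_seq (-m)
  rw [show (fun k => z' (k + -m)) = z from funext fun k => by simp [(hm _).2]] at h3
  obtain ⟨M, hM⟩ := h2 hy hy' hz h3
  refine ⟨M, fun k => ⟨?_, (hM k).2⟩⟩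
  have := (hM k).1
  rw [sub_neg_eq_add] at this
  rw [Function.comp_apply, Function.comp_apply, (hm _).1, this]

end Conjugate

theorem IsAperiodicFor.isRecognizableOn {A : Type} [Fintype A] {σ : A → List A}
    {X : Set (ℤ → A)} (hσ : ∀ a, σ a ≠ []) (hX : IsAperiodicFor σ X) : IsRecognizableOn σ X := by
  induction hn : Fintype.card A using Nat.strong_induction_on generalizing A with
  | _ n ih =>
  by_cases hE : FactorsThrough 1 σ
  · obtain ⟨B, _, β, α, hB, hβ, hα, h⟩ := hE
    have hr := ih _ (by omega) (fun b => flatMap_ne_nil hβ (hα b)) (hX.imageSet hα hβ h) rfl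
    exact (isRecognizableOn_left hβ hr).comp hα hβ h (isRecognizableOn_right hX hα hβ h hr)
  · intro x y y' c c' hy hy' hc hc'
    exact exists_shift_of_not_factorsThrough hσ hE (hX.not_periodic (hX.map_mem hy hc)) hc hc'

end Recognizable

section SubstitutionSubshift

theorem OccursAt.ofFn_isInfix {C : Type} {x : ℤ → C} {p k : ℤ} {w : List C} {l : ℕ}
    (h : OccursAt x p w) (hk : p ≤ k) (hl : k + l ≤ p + w.length) :
    (List.ofFn fun i : Fin l => x (k + (i : ℕ))) <:+: w := by
  have : (List.ofFn fun i : Fin l => x (k + (i : ℕ))) = (w.drop (k - p).toNat).take l := by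
    refine List.ext_getElem (by simp; omega) fun r h1 h2 => ?_
    rw [List.length_ofFn] at h1
    rw [List.getElem_ofFn, List.getElem_take, List.getElem_drop, ← h _ (by omega)]
    congr 1
    dsimp only
    omega
  rw [this]
  exact ⟨w.take (k - p).toNat, (w.drop (k - p).toNat).drop l, by simp [List.append_assoc]⟩

variable {A : Type} {σ : A → List A} {x : ℤ → A}

theorem InLang.flatMap {w : List A} (h : InLang σ w) : InLang σ (w.flatMap σ) := by
  obtain ⟨n, a, s, t, h⟩ := h
  refine ⟨n + 1, a, s.flatMap σ, t.flatMap σ, ?_⟩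
  rw [← List.flatMap_append, ← List.flatMap_append, h]
  rfl

theorem InLang.of_isInfix {v w : List A} (h : InLang σ w) (hv : v <:+: w) : InLang σ v := by
  obtain ⟨n, a, h⟩ := h
  exact ⟨n, a, hv.trans h⟩

theorem MemSubShift.shift (hx : MemSubShift σ x) (m : ℤ) : MemSubShift σ fun k => x (k + m) := by
  intro k l
  simpa only [add_right_comm] using hx (k + m) l

theorem MemSubShift.map_mem (hσ : ∀ a, σ a ≠ []) {y : ℤ → A} (hy : MemSubShift σ y)
    {c : ℤ → ℤ} (h : IsFactorization σ x y c) : MemSubShift σ x := by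
  intro k l
  have hmono := h.strictMono hσ
  obtain ⟨i, hi, hi'⟩ := exists_le_lt_of_strictMono hmono k
  obtain ⟨j, hj, hj'⟩ := exists_le_lt_of_strictMono hmono (k + l)
  have hij : i < j + 1 := hmono.lt_iff_lt.1 (by omega)
  obtain ⟨h1, h2⟩ := h.comp_aux (OccursAt.ofFn y i (j + 1 - i).toNat)
  refine (hy i (j + 1 - i).toNat).flatMap.of_isInfix (h2.ofFn_isInfix hi ?_)
  rw [← h1, List.length_ofFn, show i + ((j + 1 - i).toNat : ℤ) = j + 1 by omega]
  omega

/-- A sequence in the subshift agrees on every finite window with the image under `σ` of a sequence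
that belongs to the subshift as far as that window can tell. -/
theorem MemSubShift.exists_approx (hσ : ∀ a, σ a ≠ []) (hx : MemSubShift σ x) (N : ℕ) :
    ∃ x' y c, IsFactorization σ x' y c ∧ c 0 ≤ 0 ∧ 0 < c 1 ∧
      (∀ m : ℤ, -N ≤ m → m < N → x' m = x m) ∧
      ∀ (k : ℤ) (l : ℕ), -N ≤ c k → c (k + l) ≤ N →
        InLang σ (List.ofFn fun i : Fin l => y (k + (i : ℕ))) := by
  obtain ⟨n, a, hna⟩ := hx (-(N + 1 : ℕ)) (2 * (N + 1))
  cases n with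
  | zero =>
    have := hna.length_le
    simp [subIter] at this
  | succ n =>
  obtain ⟨s, t, hst⟩ := hna
  rw [subIter] at hst
  set v := subIter σ n a with hv
  have hy : OccursAt (fun j : ℤ => v.getD j.toNat a) 0 v := fun r hr => by simp [hr]
  obtain ⟨x', c, h, hc0⟩ := IsFactorization.exists_of_seq hσ (fun j : ℤ => v.getD j.toNat a)
    (-(N + 1 : ℕ) - s.length)
  obtain ⟨h1, h2⟩ := h.comp_aux hy
  rw [← hst, hc0] at h1 h2
  rw [OccursAt.append_iff, OccursAt.append_iff, sub_add_cancel] at h2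
  replace h2 := h2.1.2
  simp only [List.length_append, List.length_ofFn] at h1
  have hmono := h.strictMono hσ
  obtain ⟨i, hi, hi'⟩ := exists_le_lt_of_strictMono hmono 0
  refine ⟨x', _, _, h.shift i, by simpa using hi, by rwa [add_comm 1 i], fun m hm hm' => ?_,
    fun k l hk hl => ?_⟩
  · obtain ⟨r, rfl⟩ : ∃ r : ℕ, m = -(N + 1 : ℕ) + r := ⟨(m + (N + 1 : ℕ)).toNat, by omega⟩
    rw [h2 r (by rw [List.length_ofFn]; omega), List.getElem_ofFn]
  · have h3 : 0 < k + i := hmono.lt_iff_lt.1 (by omega)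
    have h4 : k + l + i < 0 + v.length := hmono.lt_iff_lt.1 (by omega)
    have := hy.ofFn_isInfix (k := k + i) (l := l) (by omega) (by omega)
    refine ⟨n, a, ?_⟩
    simpa only [add_right_comm] using this

theorem Ultrafilter.exists_eventually_eq {ι α : Type*} [Finite α] (U : Ultrafilter ι)
    (f : ι → α) : ∃ a, ∀ᶠ i in U, f i = a := by
  obtain ⟨a, ha⟩ := Ultrafilter.eq_pure_of_finite (U.map f)
  refine ⟨a, ?_⟩
  have : ({a} : Set α) ∈ U.map f := by
    rw [ha]
    exact Set.mem_singleton a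
  exact this

theorem MemSubShift.exists_preimage [Finite A] (hσ : ∀ a, σ a ≠ []) (hx : MemSubShift σ x) :
    ∃ y, MemSubShift σ y ∧ ∃ c, IsFactorization σ x y c := by
  cases nonempty_fintype A
  choose x' y c h hc0 hc1 hx' hL using hx.exists_approx hσ
  let U := Filter.hyperfilter ℕ
  have hU : ∀ m : ℤ, ∀ᶠ N : ℕ in U, m ≤ N := fun m =>
    Nat.hyperfilter_le_atTop ((Filter.eventually_ge_atTop m.toNat).mono fun N hN => by omega)
  choose z hz using fun k => U.exists_eventually_eq fun N => y N k
  obtain ⟨b, hb⟩ : ∃ b, ∀ᶠ N in U, c N 0 = b := by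
    have hM : ∀ N, (-(c N 0)).toNat < ∑ a, (σ a).length := fun N => by
      have h1 := (h N).step 0
      have h2 := hc0 N
      have h3 := hc1 N
      have h4 := Finset.single_le_sum (f := fun a => (σ a).length) (fun _ _ => Nat.zero_le _)
        (Finset.mem_univ (y N 0))
      rw [zero_add] at h1
      omega
    obtain ⟨b, hb⟩ := U.exists_eventually_eq fun N => (⟨_, hM N⟩ : Fin (∑ a, (σ a).length))
    refine ⟨-(b : ℕ), hb.mono fun N hN => ?_⟩
    have h2 := hc0 N
    have h3 := congrArg Fin.val hN
    dsimp only at h3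
    omega
  obtain ⟨e, he0, he⟩ := exists_eq_add_of_step (fun k => (σ (z k)).length) b
  have hce : ∀ k, ∀ᶠ N in U, c N k = e k := fun k => by
    induction k using Int.inductionOn' (b := 0) with
    | zero => rwa [he0]
    | succ k _ ih =>
      filter_upwards [ih, hz k] with N h1 h2
      rw [(h N).step, he, h1, h2]
    | pred k _ ih =>
      filter_upwards [ih, hz (k - 1)] with N h1 h2
      have h3 := (h N).step (k - 1)
      have h4 := he (k - 1)
      rw [sub_add_cancel] at h3 h4
      rw [h2] at h3
      omega
  refine ⟨z, fun k l => ?_, e, he, fun k => ?_⟩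
  · have hzl : ∀ᶠ N in U, ∀ i : Fin l, y N (k + (i : ℕ)) = z (k + (i : ℕ)) :=
      Filter.eventually_all.2 fun i => hz _
    obtain ⟨N, h1, h2, h3, h4, h5⟩ := (hzl.and <| (hce k).and <| (hce (k + l)).and <|
      (hU (-e k)).and (hU (e (k + l)))).exists
    have := hL N k l (by omega) (by omega)
    rwa [show (fun i : Fin l => y N (k + (i : ℕ))) = fun i : Fin l => z (k + (i : ℕ)) from
      funext h1] at this
  · obtain ⟨N, h1, h2, h3, h4⟩ := ((hz k).and <| (hce k).and <|
      (hU (-e k)).and (hU (e k + (σ (z k)).length))).exists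
    have := (h N).occursAt k
    rw [h1, h2] at this
    exact this.congr_seq fun r hr => (hx' N _ (by omega) (by omega)).symm

theorem isSubstDecomp_iff {y : ℤ → A} {i : ℕ} :
    IsSubstDecomp σ x y i ↔ ∃ c, c 0 = -(i : ℤ) ∧ IsFactorization σ x y c := by
  refine exists_congr fun c => and_congr_right fun _ => ⟨fun h => ⟨h.1, fun k => ?_⟩,
    fun h => ⟨h.1, fun k => ?_⟩⟩
  · exact OccursAt.eq_ofFn_iff.1 (h.2 k)
  · exact OccursAt.eq_ofFn_iff.2 (h.2 k)

end SubstitutionSubshift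

/-- **Recognizability of aperiodic substitutions (Bezuglyi–Kwiatkowski–Medynets).**
For every aperiodic substitution `σ` and every `x ∈ X_σ` there are a unique `y ∈ X_σ`
and a unique `i ∈ {0, …, |σ(y[0])| − 1}` with `x = T_σ^i σ(y)`. -/
theorem aperiodic_substitution_recognizable
    {A : Type} [Fintype A] [Nonempty A]
    (σ : A → List A) (hσ : ∀ a, σ a ≠ [])
    (haper : ∀ x : ℤ → A, MemSubShift σ x →
      ∀ p : ℕ, 0 < p → ¬(∀ i : ℤ, x (i + (p : ℤ)) = x i)) :
    ∀ x : ℤ → A, MemSubShift σ x →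
      ∃! yi : (ℤ → A) × ℕ,
        MemSubShift σ yi.1 ∧ yi.2 < (σ (yi.1 0)).length ∧
          IsSubstDecomp σ x yi.1 yi.2 := by
  have hX : IsAperiodicFor σ {x | MemSubShift σ x} :=
    ⟨fun _ hy _ _ h => hy.map_mem hσ h, fun _ hx => hx.exists_preimage hσ, haper⟩
  intro x hx
  obtain ⟨y, hy, c, h⟩ := hx.exists_preimage hσ
  obtain ⟨k, hk, hk'⟩ := exists_le_lt_of_strictMono (h.strictMono hσ) 0
  rw [h.step] at hk'
  refine ⟨(fun j => y (j + k), (-c k).toNat), ⟨hy.shift k, ?_, ?_⟩, ?_⟩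
  · dsimp only
    rw [zero_add]
    omega
  · rw [isSubstDecomp_iff]
    refine ⟨_, ?_, h.shift k⟩
    rw [zero_add]
    dsimp only
    omega
  · rintro ⟨y', i⟩ ⟨hy', hi, hd⟩
    dsimp only at hy' hi hd
    obtain ⟨c', hc', h'⟩ := isSubstDecomp_iff.1 hd
    obtain ⟨m, hm⟩ := hX.isRecognizableOn hσ hy hy' h h'
    have hmono := h.strictMono hσ
    have h1 := h'.step 0
    have h2 : c m = c' 0 := by rw [(hm 0).1, zero_add]
    have h3 : c (m + 1) = c' (0 + 1) := by rw [(hm (0 + 1)).1, zero_add, add_comm]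
    have h4 : m < k + 1 := hmono.lt_iff_lt.1 (by rw [h.step]; omega)
    have h5 : k < m + 1 := hmono.lt_iff_lt.1 (by omega)
    obtain rfl : m = k := by omega
    refine Prod.ext (funext fun j => (hm j).2) ?_
    dsimp only
    omega
end

section
/- Let B be a Bratteli diagram all of whose incidence matrix entries equal 1 (so that for each v ∈ V_{n+1} there is exactly one edge from each w ∈ V_n to v), with |V_n| ≥ 1 for all n, and let P be the uniform product probability measure on the space O_B of orders on B. Then the following dichotomy holds: (1) if Σ_n 1/|V_n| = ∞, then P-almost every order on B has a unique maximal infinite path; (2) if Σ_n 1/|V_n| < ∞, then for P-almost every order on B the set of maximal infinite paths is uncountable. -/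
open MeasureTheory

namespace BratteliDiagram

variable (B : BratteliDiagram)

/-- The index type for the vertices of `V \ V_0`. -/
def VtxIdx : Type := Σ n : ℕ, B.V (n + 1)

/-- The set `r^{-1}(v)` of edges with range `v`. -/
def EdgesTo (i : B.VtxIdx) : Type := { e : B.E i.1 // B.rng i.1 e = i.2 }

/-- A linear order on `r^{-1}(v)`, encoded as an enumeration of `r^{-1}(v)`. -/
abbrev OrdAt (i : B.VtxIdx) : Type := B.EdgesTo i ≃ Fin (Nat.card (B.EdgesTo i))

instance (i : B.VtxIdx) : MeasurableSpace (B.OrdAt i) := ⊤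

/-- The space `O_B = ∏_v P_v` of all orders on the Bratteli diagram `B`. -/
def OrderSpace : Type := ∀ i : B.VtxIdx, B.OrdAt i

instance : MeasurableSpace B.OrderSpace := by unfold OrderSpace; infer_instance

/-- A path is maximal for the order `ω` if each of its edges is maximal in
`r^{-1}(r(e))`. -/
def IsMaxPathOrd (ω : B.OrderSpace) (x : B.PathSpace) : Prop :=
  ∀ (n : ℕ) (e' : B.EdgesTo ⟨n, B.rng n (x.1 n)⟩),
    ω ⟨n, B.rng n (x.1 n)⟩ e' ≤ ω ⟨n, B.rng n (x.1 n)⟩ ⟨x.1 n, rfl⟩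

/-- A path is minimal for the order `ω` if each of its edges is minimal in
`r^{-1}(r(e))`. -/
def IsMinPathOrd (ω : B.OrderSpace) (x : B.PathSpace) : Prop :=
  ∀ (n : ℕ) (e' : B.EdgesTo ⟨n, B.rng n (x.1 n)⟩),
    ω ⟨n, B.rng n (x.1 n)⟩ ⟨x.1 n, rfl⟩ ≤ ω ⟨n, B.rng n (x.1 n)⟩ e'

/-- `P` is the uniform product probability measure on the order space `O_B`. -/
def IsUniformOrderMeasure (P : Measure B.OrderSpace) : Prop :=
  IsProbabilityMeasure P ∧
    ∀ (s : Finset B.VtxIdx) (ω₀ : B.OrderSpace),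
      P { ω : B.OrderSpace | ∀ i ∈ s, ω i = ω₀ i } =
        ∏ i ∈ s, (Nat.card (B.OrdAt i) : ENNReal)⁻¹

end BratteliDiagram

open ProbabilityTheory Filter Topology

namespace ParentMaps

section Deterministic

variable {V : ℕ → Type} [∀ n, Nonempty (V n)]

/-- The line of ancestors of `v : V m` under the parent maps `φ`: its value at `n ≤ m` is the
ancestor of `v` at level `n`, and its values at `n > m` are arbitrary. -/
noncomputable def trace (φ : ∀ n, V (n + 1) → V n) : ∀ m, V m → ∀ n, V n
  | 0, v => Function.update (fun _ => Classical.arbitrary _) 0 v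
  | m + 1, v => Function.update (trace φ m (φ m v)) (m + 1) v

variable (φ : ∀ n, V (n + 1) → V n)

@[simp]
theorem trace_self (m : ℕ) (v : V m) : trace φ m v m = v := by
  cases m <;> simp [trace]

theorem trace_succ {n m : ℕ} (h : n ≤ m) (v : V (m + 1)) :
    trace φ (m + 1) v n = trace φ m (φ m v) n := by
  rw [trace, Function.update_of_ne (by omega)]

theorem parent_trace {n m : ℕ} (h : n < m) (v : V m) :
    φ n (trace φ m v (n + 1)) = trace φ m v n := by
  induction m with
  | zero => omega
  | succ m ih =>
    rcases Nat.lt_succ_iff_lt_or_eq.1 h with h' | rfl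
    · rw [trace_succ φ (by omega), trace_succ φ (by omega), ih h']
    · rw [trace_self, trace_succ φ le_rfl, trace_self]

theorem trace_trace {n k m : ℕ} (hnk : n ≤ k) (hkm : k ≤ m) (v : V m) :
    trace φ k (trace φ m v k) n = trace φ m v n := by
  induction m, hkm using Nat.le_induction with
  | base => rw [trace_self]
  | succ m hkm ih =>
    rw [trace_succ φ hkm, ih, trace_succ φ (hnk.trans hkm)]

/-- The infinite lines of ancestors of the parent maps `φ`. -/
def lines : Set (∀ n, V n) := { y | ∀ n, φ n (y (n + 1)) = y n }

theorem trace_eq_of_mem_lines {y : ∀ n, V n} (hy : y ∈ lines φ) {n m : ℕ} (h : n ≤ m) :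
    trace φ m (y m) n = y n := by
  induction m, h using Nat.le_induction with
  | base => rw [trace_self]
  | succ m h ih => rw [trace_succ φ h, hy m, ih]

theorem existsUnique_mem_lines
    (h : ∀ n, ∃ m, n ≤ m ∧ ∀ v w : V m, trace φ m v n = trace φ m w n) :
    ∃! y, y ∈ lines φ := by
  choose m hm hc using h
  have hc' : ∀ n k, m n ≤ k → ∀ v w : V k, trace φ k v n = trace φ k w n := by
    intro n k hk v w
    rw [← trace_trace φ (hm n) hk v, ← trace_trace φ (hm n) hk w]
    exact hc n _ _
  refine ⟨fun n => trace φ (m n) (Classical.arbitrary _) n, fun n => ?_, fun y hy => ?_⟩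
  · have key : ∀ j k, m j ≤ k → ∀ v : V k,
        trace φ (m j) (Classical.arbitrary _) j = trace φ k v j := by
      intro j k hk v
      rw [← trace_trace φ (hm j) hk v]
      exact hc j _ _
    let k := m n + m (n + 1)
    have hk : n + 1 ≤ k := (hm (n + 1)).trans (Nat.le_add_left _ _)
    change φ n (trace φ (m (n + 1)) (Classical.arbitrary _) (n + 1)) =
      trace φ (m n) (Classical.arbitrary _) n
    rw [key n k (Nat.le_add_right _ _) (Classical.arbitrary _),
      key (n + 1) k (Nat.le_add_left _ _) (Classical.arbitrary _), parent_trace φ hk]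
  · funext n
    rw [← trace_eq_of_mem_lines φ hy (hm n)]
    exact hc n _ _

/-- If every vertex of a nonempty class has two distinct descendants of the class at some higher
level, then there are uncountably many infinite lines. -/
theorem not_countable_lines_of_branching (G : ∀ n, V n → Prop) (h₀ : ∃ n v, G n v)
    (h : ∀ n v, G n v → ∃ m, n < m ∧ ∃ u w : V m, G m u ∧ G m w ∧ u ≠ w ∧
      trace φ m u n = v ∧ trace φ m w n = v) :
    ¬ (lines φ).Countable := by
  intro hc
  obtain ⟨f, hf⟩ : ∃ f : ℕ → ∀ n, V n, lines φ ⊆ Set.range f := by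
    have : Nonempty (∀ n, V n) := inferInstance
    exact (Set.countable_iff_exists_subset_range).1 hc
  obtain ⟨n₀, v₀, hv₀⟩ := h₀
  let T := { z : Σ n, V n // G z.1 z.2 }
  have step : ∀ (i : ℕ) (z : T), ∃ z' : T, z.1.1 < z'.1.1 ∧
      trace φ z'.1.1 z'.1.2 z.1.1 = z.1.2 ∧ f i z'.1.1 ≠ z'.1.2 := by
    rintro i ⟨⟨n, v⟩, hv⟩
    obtain ⟨m, hm, u, w, hu, hw, huw, htu, htw⟩ := h n v hv
    by_cases hfu : f i m = u
    · exact ⟨⟨⟨m, w⟩, hw⟩, hm, htw, fun e => huw (hfu.symm.trans e)⟩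
    · exact ⟨⟨⟨m, u⟩, hu⟩, hm, htu, hfu⟩
  choose nxt hlt htr hne using step
  let z : ℕ → T := fun i => Nat.rec ⟨⟨n₀, v₀⟩, hv₀⟩ (fun i z => nxt i z) i
  have hz : ∀ i, z (i + 1) = nxt i (z i) := fun i => rfl
  have hmono : StrictMono fun i => (z i).1.1 := strictMono_nat_of_lt_succ fun i => by
    rw [hz]; exact hlt i (z i)
  have hz' : ∀ i j, i ≤ j → trace φ (z j).1.1 (z j).1.2 (z i).1.1 = (z i).1.2 := by
    intro i j hij
    induction j, hij using Nat.le_induction with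
    | base => rw [trace_self]
    | succ j hij ih =>
      have h1 := htr j (z j)
      rw [← hz] at h1
      rw [← trace_trace φ (hmono.monotone hij) (hmono.monotone j.le_succ), h1, ih]
  let y : ∀ n, V n := fun n => trace φ (z n).1.1 (z n).1.2 n
  have hy : ∀ n i, n ≤ (z i).1.1 → trace φ (z i).1.1 (z i).1.2 n = y n := by
    intro n i hi
    change _ = trace φ (z n).1.1 (z n).1.2 n
    rcases le_total n i with hni | hni
    · rw [← hz' n i hni, trace_trace φ (hmono.le_apply) (hmono.monotone hni)]
    · rw [← hz' i n hni, trace_trace φ hi (hmono.monotone hni)]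
  have hyl : y ∈ lines φ := by
    intro n
    have h1 : n + 1 ≤ (z (n + 1)).1.1 := hmono.le_apply
    rw [← hy (n + 1) (n + 1) h1, parent_trace φ h1, hy n (n + 1) (by omega)]
  obtain ⟨i, hi⟩ := hf hyl
  apply hne i (z i)
  rw [← hz, hi, ← hy _ (i + 1) le_rfl, trace_self]

variable [∀ n, Fintype (V n)]

/-- The proportion of the vertices of level `m` which descend from `u : V l`. -/
noncomputable def share (l : ℕ) (u : V l) (m : ℕ) : ℝ :=
  open Classical in (Fintype.card (V m) : ℝ)⁻¹ * ∑ v : V m, if trace φ m v l = u then 1 else 0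

theorem share_eq_sum_share {l k m : ℕ} (hlk : l ≤ k) (hkm : k ≤ m) (u : V l) :
    share φ l u m =
      open Classical in ∑ w : V k, if trace φ k w l = u then share φ k w m else 0 := by
  classical
  simp only [share]
  have : ∀ w : V k, (if trace φ k w l = u then (Fintype.card (V m) : ℝ)⁻¹ *
      ∑ v : V m, (if trace φ m v k = w then (1 : ℝ) else 0) else 0) =
      (Fintype.card (V m) : ℝ)⁻¹ *
      ∑ v : V m, if trace φ m v k = w then (if trace φ k w l = u then (1 : ℝ) else 0) else 0 := by
    intro w
    split_ifs <;> simp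
  simp only [this, ← Finset.mul_sum]
  rw [Finset.sum_comm]
  simp [trace_trace φ hlk hkm]

theorem share_nonneg (l : ℕ) (u : V l) (m : ℕ) : 0 ≤ share φ l u m := by
  unfold share; positivity

theorem sum_share (l m : ℕ) : ∑ u : V l, share φ l u m = 1 := by
  classical
  simp only [share, ← Finset.mul_sum]
  rw [Finset.sum_comm]
  simp

theorem share_le_one (l : ℕ) (u : V l) (m : ℕ) : share φ l u m ≤ 1 := by
  rw [← sum_share φ l m]
  exact Finset.single_le_sum (fun w _ => share_nonneg φ l w m) (Finset.mem_univ u)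

theorem not_countable_lines_of_tendsto_share (q : ∀ l, V l → ℝ)
    (hq : ∀ l u, Tendsto (share φ l u) atTop (𝓝 (q l u)))
    (hsq : ∀ ε > 0, ∀ n, ∃ l > n, ∑ u : V l, q l u ^ 2 < ε) :
    ¬ (lines φ).Countable := by
  classical
  have hsum : ∀ l, ∑ u : V l, q l u = 1 := fun l => by
    refine tendsto_nhds_unique (tendsto_finsetSum _ fun u _ => hq l u) ?_
    simp [sum_share]
  have h0 : ∀ l u, 0 ≤ q l u := fun l u => ge_of_tendsto' (hq l u) (share_nonneg φ l u)
  have hadd : ∀ l k, l ≤ k → ∀ u : V l,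
      q l u = ∑ w : V k, if trace φ k w l = u then q k w else 0 := by
    intro l k hlk u
    refine tendsto_nhds_unique (hq l u) ?_
    have : Tendsto (fun m => ∑ w : V k, if trace φ k w l = u then share φ k w m else 0) atTop
        (𝓝 (∑ w : V k, if trace φ k w l = u then q k w else 0)) := by
      refine tendsto_finsetSum _ fun w _ => ?_
      split_ifs
      · exact hq k w
      · exact tendsto_const_nhds
    refine this.congr' ?_
    filter_upwards [eventually_ge_atTop k] with m hm
    exact (share_eq_sum_share φ hlk hm u).symm
  refine not_countable_lines_of_branching φ (fun n v => 0 < q n v) ?_ ?_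
  · by_contra! hcon
    have : ∑ u : V 0, q 0 u ≤ 0 := Finset.sum_nonpos fun u _ => hcon 0 u
    rw [hsum] at this
    linarith
  · intro n v hv
    obtain ⟨m, hm, hlt⟩ := hsq (q n v ^ 2) (by positivity) n
    refine ⟨m, hm, ?_⟩
    by_contra! hcon
    obtain ⟨u, hut, hu⟩ : ∃ u : V m, trace φ m u n = v ∧ 0 < q m u := by
      by_contra! hcon'
      have : q n v ≤ 0 := by
        rw [hadd n m hm.le v]
        refine Finset.sum_nonpos fun w _ => ?_
        split_ifs with hw
        · exact hcon' w hw
        · exact le_rfl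
      linarith
    have hqu : q n v = q m u := by
      rw [hadd n m hm.le v, Finset.sum_eq_single u]
      · simp [hut]
      · intro w _ hwu
        split_ifs with hw
        · by_contra hne
          exact hcon u w hu (lt_of_le_of_ne (h0 m w) (Ne.symm hne)) (Ne.symm hwu) hut hw
        · rfl
      · simp
    rw [hqu] at hlt
    exact absurd hlt (not_lt.2
      (Finset.single_le_sum (f := fun w => q m w ^ 2) (fun w _ => sq_nonneg _)
        (Finset.mem_univ u)))

end Deterministic

section Estimate

theorem geom_sum_add_one_mul_le {q : ℝ} (h0 : 0 ≤ q) (h1 : q ≤ 1) (k : ℕ) :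
    ((∑ i ∈ Finset.range (k + 1), q ^ i) + 1) * (2 + (1 - q) / 2 * k) ≤ 2 * (k + 2) := by
  induction k with
  | zero => norm_num
  | succ k ih =>
    rw [geom_sum_succ]
    set M := ∑ i ∈ Finset.range (k + 1), q ^ i
    have hk : (0 : ℝ) ≤ k := k.cast_nonneg
    obtain ⟨d, rfl⟩ : ∃ d, q = 1 - 2 * d := ⟨(1 - q) / 2, by ring⟩
    have hd0 : 0 ≤ d := by linarith
    have hd1 : d ≤ 1 / 2 := by linarith
    have hD : 0 < 2 + d * k := by positivity
    have e : (1 - (1 - 2 * d)) / 2 = d := by ring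
    rw [e] at ih ⊢
    push_cast
    have hM : M + 1 ≤ 2 * (k + 2) / (2 + d * k) := (le_div_iff₀ hD).2 ih
    have hstep : (1 - 2 * d) * M + 1 + 1 ≤
        (1 - 2 * d) * (2 * (k + 2) / (2 + d * k)) + (1 + 2 * d) := by
      have := mul_le_mul_of_nonneg_left hM h0
      linarith
    refine (mul_le_mul_of_nonneg_right hstep (by positivity)).trans ?_
    rw [show (1 - 2 * d) * (2 * (k + 2) / (2 + d * k)) + (1 + 2 * d) =
      ((1 - 2 * d) * (2 * (k + 2)) + (1 + 2 * d) * (2 + d * k)) / (2 + d * k) by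
        field_simp, div_mul_eq_mul_div, div_le_iff₀ hD]
    have hk2 : 0 ≤ d * d * k * (k + 1) * (1 - 2 * d) := by
      have : 0 ≤ 1 - 2 * d := h0
      positivity
    have : 0 ≤ d * k := by positivity
    have : 0 ≤ d * d * k * k := by positivity
    have : 0 ≤ d * d * k := by positivity
    have : 0 ≤ d * d := by positivity
    nlinarith

/-- The potential of a set of `j` vertices, which vanishes exactly when `j = 1`. -/
noncomputable def potential (j : ℕ) : ℝ := 1 - 2 / (j + 1)

theorem potential_geom_sum_le {q : ℝ} (h0 : 0 ≤ q) (h1 : q ≤ 1) {j : ℕ} (hj : 1 ≤ j) :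
    1 - 2 / ((∑ i ∈ Finset.range j, q ^ i) + 1) ≤ (1 - (1 - q) / 2) * potential j := by
  obtain ⟨k, rfl⟩ : ∃ k, j = k + 1 := ⟨j - 1, by omega⟩
  have h := geom_sum_add_one_mul_le h0 h1 k
  have hM : 0 ≤ ∑ i ∈ Finset.range (k + 1), q ^ i := Finset.sum_nonneg fun _ _ => by positivity
  set M := ∑ i ∈ Finset.range (k + 1), q ^ i
  have hk : (0 : ℝ) ≤ k := k.cast_nonneg
  have hc : (2 + (1 - q) / 2 * k) / (k + 2) ≤ 2 / (M + 1) := by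
    rw [div_le_div_iff₀ (by positivity) (by positivity)]
    linarith
  have e : (1 - (1 - q) / 2) * potential (k + 1) = 1 - (2 + (1 - q) / 2 * k) / (k + 2) := by
    unfold potential
    push_cast
    field_simp
    ring
  rw [e]
  linarith

theorem potential_le_tangent (j : ℕ) {M : ℝ} (hM : 0 ≤ M) :
    potential j ≤ 1 - 2 / (M + 1) + 2 / (M + 1) ^ 2 * (j - M) := by
  have hj : (0 : ℝ) ≤ j := j.cast_nonneg
  have e : 1 - 2 / (M + 1) + 2 / (M + 1) ^ 2 * (j - M) - potential j =
      2 * (j - M) ^ 2 / ((M + 1) ^ 2 * (j + 1)) := by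
    unfold potential
    field_simp
    ring
  have : 0 ≤ 2 * (j - M) ^ 2 / ((M + 1) ^ 2 * (j + 1)) := by positivity
  linarith

theorem tendsto_prod_one_sub_of_not_summable {x : ℕ → ℝ} (h0 : ∀ k, 0 ≤ x k) (h1 : ∀ k, x k ≤ 1)
    (hx : ¬ Summable x) (n : ℕ) :
    Tendsto (fun m => ∏ k ∈ Finset.Ico n m, (1 - x k)) atTop (𝓝 0) := by
  have hdiv : Tendsto (fun m => ∑ k ∈ Finset.range m, x k) atTop atTop :=
    (not_summable_iff_tendsto_nat_atTop_of_nonneg h0).1 hx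
  have hIco : Tendsto (fun m => ∑ k ∈ Finset.Ico n m, x k) atTop atTop := by
    have := tendsto_atTop_add_const_right atTop (-∑ k ∈ Finset.range n, x k) hdiv
    refine this.congr' ?_
    filter_upwards [eventually_ge_atTop n] with m hm
    rw [Finset.sum_Ico_eq_sub _ hm, sub_eq_add_neg]
  have hexp := Real.tendsto_exp_atBot.comp (tendsto_neg_atTop_atBot.comp hIco)
  refine squeeze_zero (fun m => Finset.prod_nonneg fun k _ => sub_nonneg.2 (h1 k)) (fun m => ?_)
    hexp
  simp only [Function.comp_apply, ← Finset.sum_neg_distrib, Real.exp_sum]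
  exact Finset.prod_le_prod (fun k _ => sub_nonneg.2 (h1 k)) fun k _ => by
    have := Real.add_one_le_exp (-x k)
    linarith

theorem sum_sum_le_of_le_ite {α : Type*} [Fintype α] [DecidableEq α] {a : α → α → ℝ} {τ : ℝ}
    (hτ : 0 ≤ τ) (h : ∀ x y, a x y ≤ if x = y then 1 else τ) :
    ∑ x, ∑ y, a x y ≤ Fintype.card α + Fintype.card α * Fintype.card α * τ := by
  calc ∑ x, ∑ y, a x y ≤ ∑ x : α, ∑ y : α, ((if x = y then 1 else 0) + τ) := by
        refine Finset.sum_le_sum fun x _ => Finset.sum_le_sum fun y _ => (h x y).trans ?_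
        split_ifs <;> simp [hτ]
    _ = _ := by
        simp [Finset.sum_add_distrib, mul_assoc]

end Estimate

section Random

set_option linter.unusedSectionVars false

variable {V : ℕ → Type} [∀ n, Fintype (V n)] [∀ n, Nonempty (V n)]
  [∀ n, MeasurableSpace (V n)] [∀ n, MeasurableSingletonClass (V n)]
  {Ω : Type*} [MeasurableSpace Ω]

/-- The parents `Φ n · v` of the vertices `v` are independent, and each is uniformly
distributed. -/
structure IsUniform (P : Measure Ω) (Φ : ∀ n, Ω → V (n + 1) → V n) : Prop where
  measurable_parent : ∀ n v, Measurable fun ω => Φ n ω v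
  iIndepFun_parent : iIndepFun (fun (i : Σ n, V (n + 1)) ω => Φ i.1 ω i.2) P
  real_parent_eq : ∀ n v w, P.real { ω | Φ n ω v = w } = (Fintype.card (V n) : ℝ)⁻¹

namespace IsUniform

variable {P : Measure Ω} [IsProbabilityMeasure P] {Φ : ∀ n, Ω → V (n + 1) → V n}

/-- The filtration generated by the parents of the vertices up to a given level. -/
def past (h : IsUniform P Φ) : Filtration ℕ (‹_› : MeasurableSpace Ω) where
  seq m := ⨆ i ∈ { i : Σ n, V (n + 1) | i.1 < m },
    MeasurableSpace.comap (fun ω => Φ i.1 ω i.2) inferInstance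
  mono' _ _ hmn := biSup_mono fun _ hi => lt_of_lt_of_le hi hmn
  le' _ := iSup₂_le fun i _ => (h.measurable_parent i.1 i.2).comap_le

/-- The σ-algebra generated by the parents of the vertices of level `m + 1`. -/
@[reducible]
def present (_ : IsUniform P Φ) (m : ℕ) : MeasurableSpace Ω :=
  ⨆ i ∈ { i : Σ n, V (n + 1) | i.1 = m },
    MeasurableSpace.comap (fun ω => Φ i.1 ω i.2) inferInstance

variable (h : IsUniform P Φ)
include h

theorem indep_past_present (m : ℕ) : Indep (h.past m) (h.present m) P :=
  indep_iSup_of_disjoint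
    (m := fun i : Σ n, V (n + 1) => MeasurableSpace.comap (fun ω => Φ i.1 ω i.2) inferInstance)
    (fun i => (h.measurable_parent i.1 i.2).comap_le)
    h.iIndepFun_parent.iIndep
    (Set.disjoint_left.2 fun _ hi hi' => (ne_of_lt hi) hi')

theorem measurable_parent_present (m : ℕ) (v : V (m + 1)) :
    Measurable[h.present m] fun ω => Φ m ω v :=
  Measurable.mono (comap_measurable _)
    (le_iSup₂_of_le (f := fun (i : Σ n, V (n + 1)) (_ : i ∈ { i : Σ n, V (n + 1) | i.1 = m }) =>
      MeasurableSpace.comap (fun ω => Φ i.1 ω i.2) inferInstance) ⟨m, v⟩ rfl le_rfl) le_rfl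

theorem measurable_parent_past {n m : ℕ} (hnm : n < m) (v : V (n + 1)) :
    Measurable[h.past m] fun ω => Φ n ω v :=
  Measurable.mono (comap_measurable _)
    (le_iSup₂_of_le (f := fun (i : Σ n, V (n + 1)) (_ : i ∈ { i : Σ n, V (n + 1) | i.1 < m }) =>
      MeasurableSpace.comap (fun ω => Φ i.1 ω i.2) inferInstance) ⟨n, v⟩ hnm le_rfl) le_rfl

theorem measurable_trace (m n : ℕ) (v : V m) :
    Measurable[h.past m] fun ω => trace (fun k => Φ k ω) m v n := by
  induction m with
  | zero => exact measurable_const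
  | succ m ih =>
    by_cases hn : n = m + 1
    · subst hn
      simp only [trace_self]
      exact measurable_const
    · have e : (fun ω => trace (fun k => Φ k ω) (m + 1) v n) =
          fun ω => trace (fun k => Φ k ω) m (Φ m ω v) n := by
        funext ω
        rw [trace, Function.update_of_ne hn]
      rw [e]
      refine @measurable_to_countable' _ _ _ _ (h.past (m + 1)) _ fun w => ?_
      have e2 : (fun ω => trace (fun k => Φ k ω) m (Φ m ω v) n) ⁻¹' {w} =
          ⋃ u : V m, (fun ω => Φ m ω v) ⁻¹' {u} ∩
            (fun ω => trace (fun k => Φ k ω) m u n) ⁻¹' {w} := by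
        ext ω
        simp
      rw [e2]
      exact MeasurableSet.iUnion fun u =>
        (h.measurable_parent_past m.lt_succ_self v (measurableSet_singleton u)).inter
          ((h.past.mono m.le_succ) _ (ih u (measurableSet_singleton w)))

theorem real_inter_parent {m : ℕ} {D : Set Ω} (hD : MeasurableSet[h.past m] D)
    (v : V (m + 1)) (w : V m) :
    P.real (D ∩ { ω | Φ m ω v = w }) = P.real D * (Fintype.card (V m) : ℝ)⁻¹ := by
  have := (Indep_iff _ _ _).1 (h.indep_past_present m) D { ω | Φ m ω v = w } hD
    (h.measurable_parent_present m v (measurableSet_singleton w))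
  rw [measureReal_def, this, ENNReal.toReal_mul, ← measureReal_def, ← measureReal_def,
    h.real_parent_eq]

theorem real_biInter_parent (m : ℕ) (S : Finset (V (m + 1))) (t : V (m + 1) → Set (V m)) :
    P.real (⋂ v ∈ S, { ω | Φ m ω v ∈ t v }) = ∏ v ∈ S, P.real { ω | Φ m ω v ∈ t v } := by
  have hg : Function.Injective fun v : V (m + 1) => (⟨m, v⟩ : Σ n, V (n + 1)) :=
    fun v w hvw => by simpa using hvw
  have := (h.iIndepFun_parent.precomp hg).measure_inter_preimage_eq_mul S (sets := t)
    (fun v _ => (Set.toFinite _).measurableSet)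
  rw [measureReal_def]
  exact (congrArg ENNReal.toReal this).trans (ENNReal.toReal_prod _ _)

theorem real_inter_parent_pair {m : ℕ} {D : Set Ω} (hD : MeasurableSet[h.past m] D)
    {v v' : V (m + 1)} (hv : v ≠ v') (w w' : V m) :
    P.real (D ∩ { ω | Φ m ω v = w ∧ Φ m ω v' = w' }) =
      P.real D * ((Fintype.card (V m) : ℝ)⁻¹ * (Fintype.card (V m) : ℝ)⁻¹) := by
  classical
  have h1 := (Indep_iff _ _ _).1 (h.indep_past_present m) D { ω | Φ m ω v = w ∧ Φ m ω v' = w' } hD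
    ((h.measurable_parent_present m v (measurableSet_singleton w)).inter
      (h.measurable_parent_present m v' (measurableSet_singleton w')))
  rw [measureReal_def, h1, ENNReal.toReal_mul, ← measureReal_def, ← measureReal_def]
  have h2 := h.real_biInter_parent m {v, v'} (fun x => if x = v then {w} else {w'})
  rw [Finset.prod_pair hv] at h2
  simp only [if_true, if_neg hv.symm, Set.mem_singleton_iff, h.real_parent_eq] at h2
  rw [← h2]
  congr 2
  ext ω
  simp [hv.symm]

theorem real_forall_parent_ne (m : ℕ) (S : Finset (V (m + 1))) (w : V m) :
    P.real { ω | ∀ v ∈ S, Φ m ω v ≠ w } = (1 - (Fintype.card (V m) : ℝ)⁻¹) ^ S.card := by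
  have h2 := h.real_biInter_parent m S (fun _ => {w}ᶜ)
  have h3 : ∀ v, P.real { ω | Φ m ω v ∈ ({w}ᶜ : Set (V m)) } = 1 - (Fintype.card (V m) : ℝ)⁻¹ := by
    intro v
    rw [← h.real_parent_eq m v w, ← probReal_compl_eq_one_sub]
    · rfl
    · exact h.measurable_parent m v (measurableSet_singleton w)
  simp only [h3, Finset.prod_const] at h2
  rw [← h2]
  congr 1
  ext ω
  simp

theorem measurable_parents (m : ℕ) : Measurable[h.present m] (Φ m) :=
  @measurable_pi_lambda _ _ _ (h.present m) _ _ fun v => h.measurable_parent_present m v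

theorem present_le (m : ℕ) : h.present m ≤ ‹MeasurableSpace Ω› :=
  iSup₂_le fun i _ => (h.measurable_parent i.1 i.2).comap_le

theorem measurable_traces (m n : ℕ) :
    Measurable[h.past m] fun ω v => trace (fun k => Φ k ω) m v n :=
  @measurable_pi_lambda _ _ _ (h.past m) _ _ fun v => h.measurable_trace m n v

theorem integrable_comp_parents (m : ℕ) (F : (V (m + 1) → V m) → ℝ) :
    Integrable (fun ω => F (Φ m ω)) P :=
  (Integrable.of_finite (μ := P.map (Φ m)) (f := F)).comp_measurable
    ((h.measurable_parents m).mono (h.present_le m) le_rfl)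

theorem integrable_comp_traces (m n : ℕ) (F : (V m → V n) → ℝ) :
    Integrable (fun ω => F fun v => trace (fun k => Φ k ω) m v n) P :=
  (Integrable.of_finite (μ := P.map fun ω v => trace (fun k => Φ k ω) m v n)
    (f := F)).comp_measurable ((h.measurable_traces m n).mono (h.past.le m) le_rfl)

theorem integral_mul_comp (m n : ℕ) (F : (V (m + 1) → V m) → ℝ) (G : (V m → V n) → ℝ) :
    ∫ ω, F (Φ m ω) * G (fun v => trace (fun k => Φ k ω) m v n) ∂P =
      (∫ ω, F (Φ m ω) ∂P) * ∫ ω, G (fun v => trace (fun k => Φ k ω) m v n) ∂P := by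
  refine IndepFun.integral_fun_mul_eq_mul_integral ?_
    (h.integrable_comp_parents m F).aestronglyMeasurable
    (h.integrable_comp_traces m n G).aestronglyMeasurable
  rw [IndepFun_iff_Indep]
  exact indep_of_indep_of_le_left (indep_of_indep_of_le_right (h.indep_past_present m).symm
    ((Measurable.of_discrete (f := G)).comp (h.measurable_traces m n)).comap_le)
    ((Measurable.of_discrete (f := F)).comp (h.measurable_parents m)).comap_le

theorem integral_card_image_parent (m : ℕ) (S : Finset (V (m + 1))) :
    ∫ ω, (open Classical in ((S.image (Φ m ω)).card : ℝ)) ∂P =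
      ∑ i ∈ Finset.range S.card, (1 - (Fintype.card (V m) : ℝ)⁻¹) ^ i := by
  classical
  have hN : (Fintype.card (V m) : ℝ) ≠ 0 := by simp
  have e : ∀ ω, ((S.image (Φ m ω)).card : ℝ) =
      ∑ w : V m, (1 - Set.indicator { ω | ∀ v ∈ S, Φ m ω v ≠ w } (fun _ => (1 : ℝ)) ω) := by
    intro ω
    have : S.image (Φ m ω) = Finset.univ.filter fun w => w ∈ S.image (Φ m ω) := by
      ext w
      simp
    rw [this, Finset.card_filter, Nat.cast_sum]
    refine Finset.sum_congr rfl fun w _ => ?_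
    by_cases hw : ∃ v ∈ S, Φ m ω v = w
    · have h1 : w ∈ S.image (Φ m ω) := by simpa using hw
      have h2 : ω ∉ { ω | ∀ v ∈ S, Φ m ω v ≠ w } := by simpa using hw
      simp [h1, Set.indicator_of_notMem h2]
    · have h1 : w ∉ S.image (Φ m ω) := by simpa using hw
      have h2 : ω ∈ { ω | ∀ v ∈ S, Φ m ω v ≠ w } := by simpa using hw
      simp [h1, Set.indicator_of_mem h2]
  have hms : ∀ w, MeasurableSet { ω | ∀ v ∈ S, Φ m ω v ≠ w } := fun w =>
    (h.present_le m) _ (h.measurable_parents m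
      (Set.toFinite { g : V (m + 1) → V m | ∀ v ∈ S, g v ≠ w }).measurableSet)
  simp_rw [e]
  rw [integral_finsetSum]
  swap
  · exact fun w _ => (integrable_const _).sub ((integrable_const _).indicator (hms w))
  have e2 : ∀ w : V m, ∫ ω, (1 - Set.indicator { ω | ∀ v ∈ S, Φ m ω v ≠ w }
      (fun _ => (1 : ℝ)) ω) ∂P = 1 - (1 - (Fintype.card (V m) : ℝ)⁻¹) ^ S.card := by
    intro w
    rw [integral_sub (integrable_const _) ((integrable_const _).indicator (hms w)),
      integral_indicator_const _ (hms w), h.real_forall_parent_ne]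
    simp
  simp_rw [e2]
  have hg := geom_sum_mul (1 - (Fintype.card (V m) : ℝ)⁻¹) S.card
  rw [Finset.sum_const, Finset.card_univ, nsmul_eq_mul]
  field_simp at hg ⊢
  linarith

theorem integral_potential_image_parent_le (m : ℕ) {S : Finset (V (m + 1))} (hS : S.Nonempty) :
    ∫ ω, (open Classical in potential (S.image (Φ m ω)).card) ∂P ≤
      (1 - (Fintype.card (V m) : ℝ)⁻¹ / 2) * potential S.card := by
  classical
  have hN : (1 : ℝ) ≤ Fintype.card (V m) := by exact_mod_cast Fintype.card_pos
  have hq0 : 0 ≤ 1 - (Fintype.card (V m) : ℝ)⁻¹ := sub_nonneg.2 (inv_le_one_of_one_le₀ hN)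
  have hq1 : 1 - (Fintype.card (V m) : ℝ)⁻¹ ≤ 1 := by
    have : 0 ≤ (Fintype.card (V m) : ℝ)⁻¹ := by positivity
    linarith
  have hM := h.integral_card_image_parent m S
  have hgs := potential_geom_sum_le hq0 hq1 hS.card_pos
  set M := ∑ i ∈ Finset.range S.card, (1 - (Fintype.card (V m) : ℝ)⁻¹) ^ i
  have hM0 : 0 ≤ M := Finset.sum_nonneg fun _ _ => by positivity
  have hcard := h.integrable_comp_parents m fun g => ((S.image g).card : ℝ)
  calc ∫ ω, potential (S.image (Φ m ω)).card ∂P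
      ≤ ∫ ω, (1 - 2 / (M + 1) + 2 / (M + 1) ^ 2 * (((S.image (Φ m ω)).card : ℝ) - M)) ∂P :=
        integral_mono (h.integrable_comp_parents m fun g => potential (S.image g).card)
          (h.integrable_comp_parents m fun g =>
            (1 - 2 / (M + 1) + 2 / (M + 1) ^ 2 * (((S.image g).card : ℝ) - M)))
          fun ω => potential_le_tangent _ hM0
    _ = 1 - 2 / (M + 1) := by
        have hsub : Integrable (fun ω => ((S.image (Φ m ω)).card : ℝ) - M) P :=
          hcard.sub (integrable_const _)
        rw [integral_add (integrable_const _) (hsub.const_mul _),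
          integral_const_mul, integral_sub hcard (integrable_const _), hM]
        simp
    _ ≤ _ := by
        refine hgs.trans_eq ?_
        ring

theorem integral_potential_image_trace_le {n m : ℕ} (hnm : n ≤ m) {S : Finset (V m)}
    (hS : S.Nonempty) :
    ∫ ω, (open Classical in
        potential (S.image fun v => trace (fun k => Φ k ω) m v n).card) ∂P ≤
      (∏ k ∈ Finset.Ico n m, (1 - (Fintype.card (V k) : ℝ)⁻¹ / 2)) * potential S.card := by
  classical
  induction m, hnm using Nat.le_induction with
  | base => simp
  | succ m hnm ih =>
    set C := ∏ k ∈ Finset.Ico n m, (1 - (Fintype.card (V k) : ℝ)⁻¹ / 2) with hC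
    have hC0 : 0 ≤ C := Finset.prod_nonneg fun k _ => by
      have hN : (1 : ℝ) ≤ Fintype.card (V k) := by exact_mod_cast Fintype.card_pos
      have := inv_le_one_of_one_le₀ hN
      linarith
    let F : Finset (V m) → (V (m + 1) → V m) → ℝ := fun T g => if S.image g = T then 1 else 0
    let G : Finset (V m) → (V m → V n) → ℝ := fun T g => potential (T.image g).card
    have e : ∀ ω, potential (S.image fun v => trace (fun k => Φ k ω) (m + 1) v n).card =
        ∑ T : Finset (V m), F T (Φ m ω) * G T fun v => trace (fun k => Φ k ω) m v n := by
      intro ω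
      simp only [F, G, ite_mul, one_mul, zero_mul, Finset.sum_ite_eq, Finset.mem_univ, if_true,
        Finset.image_image, trace_succ _ hnm]
      rfl
    have e2 : ∀ ω, potential (S.image (Φ m ω)).card =
        ∑ T : Finset (V m), F T (Φ m ω) * potential T.card := by
      intro ω
      simp [F]
    simp_rw [e]
    rw [integral_finsetSum]
    · calc ∑ T : Finset (V m), ∫ ω, F T (Φ m ω) * G T (fun v => trace (fun k => Φ k ω) m v n) ∂P
          ≤ ∑ T : Finset (V m), ∫ ω, C * (F T (Φ m ω) * potential T.card) ∂P := by
            refine Finset.sum_le_sum fun T _ => ?_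
            rw [h.integral_mul_comp, integral_const_mul, integral_mul_const, mul_left_comm]
            rcases T.eq_empty_or_nonempty with rfl | hT
            · have : ∀ g, F ∅ g = 0 := fun g => by
                simp [F, hS.ne_empty]
              simp [this]
            · exact mul_le_mul_of_nonneg_left (ih hT)
                (integral_nonneg fun ω => by simp only [F, Pi.zero_apply]; split_ifs <;> simp)
        _ = C * ∫ ω, potential (S.image (Φ m ω)).card ∂P := by
            simp_rw [e2, integral_const_mul]
            rw [← Finset.mul_sum, integral_finsetSum]
            exact fun T _ => h.integrable_comp_parents m fun g => F T g * potential T.card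
        _ ≤ C * ((1 - (Fintype.card (V m) : ℝ)⁻¹ / 2) * potential S.card) :=
            mul_le_mul_of_nonneg_left (h.integral_potential_image_parent_le m hS) hC0
        _ = _ := by rw [Finset.prod_Ico_succ_top hnm, ← hC, mul_assoc]
    · intro T _
      exact ((h.integrable_comp_traces m n (G T)).const_mul 1).bdd_mul (c := 1)
        (h.integrable_comp_parents m (F T)).aestronglyMeasurable
        (ae_of_all _ fun ω => by simp only [F]; split_ifs <;> simp) |>.congr
          (ae_of_all _ fun ω => by simp)

theorem ae_exists_trace_eq
    (hdiv : ¬ Summable fun n => (Fintype.card (V n) : ℝ)⁻¹) :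
    ∀ᵐ ω ∂P, ∀ n, ∃ m, n ≤ m ∧ ∀ v w : V m,
      trace (fun k => Φ k ω) m v n = trace (fun k => Φ k ω) m w n := by
  classical
  rw [ae_all_iff]
  intro n
  have hx : ¬ Summable fun k => (Fintype.card (V k) : ℝ)⁻¹ / 2 := fun hs => hdiv <| by
    simpa using hs.mul_right 2
  have hlim := (tendsto_prod_one_sub_of_not_summable (fun k => by positivity) (fun k => by
      have hN : (1 : ℝ) ≤ Fintype.card (V k) := by exact_mod_cast Fintype.card_pos
      have := inv_le_one_of_one_le₀ hN
      linarith) hx n).const_mul 3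
  rw [mul_zero] at hlim
  let A : ℕ → Set Ω := fun m => { ω | ¬ ∀ v w : V m,
      trace (fun k => Φ k ω) m v n = trace (fun k => Φ k ω) m w n }
  have hA : ∀ m, n ≤ m →
      P.real (A m) ≤ 3 * ∏ k ∈ Finset.Ico n m, (1 - (Fintype.card (V k) : ℝ)⁻¹ / 2) := by
    intro m hm
    have hint := h.integral_potential_image_trace_le hm (Finset.univ_nonempty (α := V m))
    have hpot0 : ∀ j : ℕ, 1 ≤ j → 0 ≤ potential j := fun j hj => by
      have : (1 : ℝ) ≤ j := by exact_mod_cast hj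
      unfold potential
      rw [sub_nonneg, div_le_one (by positivity)]
      linarith
    have hpot1 : potential (Finset.univ : Finset (V m)).card ≤ 1 := by
      unfold potential
      have : (0 : ℝ) ≤ 2 / ((Finset.univ : Finset (V m)).card + 1) := by positivity
      linarith
    have hpot2 : ∀ j : ℕ, 2 ≤ j → 1 / 3 ≤ potential j := fun j hj => by
      have hj' : (2 : ℝ) ≤ j := by exact_mod_cast hj
      unfold potential
      rw [le_sub_comm, div_le_iff₀ (by positivity)]
      linarith
    have hms : MeasurableSet (A m) := h.past.le m _ (h.measurable_traces m n
      (Set.toFinite { g : V m → V n | ¬ ∀ v w : V m, g v = g w }).measurableSet)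
    have hle : P.real (A m) * (1 / 3) ≤ ∫ ω,
        potential (Finset.univ.image fun v => trace (fun k => Φ k ω) m v n).card ∂P := by
      rw [← smul_eq_mul, ← integral_indicator_const _ hms]
      refine integral_mono ((integrable_const _).indicator hms) (h.integrable_comp_traces m n
        fun g => potential (Finset.univ.image g).card) fun ω => ?_
      by_cases hω : ω ∈ A m
      · rw [Set.indicator_of_mem hω]
        apply hpot2
        obtain ⟨v, w, hvw⟩ : ∃ v w : V m,
            trace (fun k => Φ k ω) m v n ≠ trace (fun k => Φ k ω) m w n := by
          simpa [A] using hω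
        exact Finset.one_lt_card.2 ⟨_, Finset.mem_image_of_mem _ (Finset.mem_univ v), _,
          Finset.mem_image_of_mem _ (Finset.mem_univ w), hvw⟩
      · rw [Set.indicator_of_notMem hω]
        exact hpot0 _ (Finset.univ_nonempty.image _).card_pos
    have hC0 : 0 ≤ ∏ k ∈ Finset.Ico n m, (1 - (Fintype.card (V k) : ℝ)⁻¹ / 2) :=
      Finset.prod_nonneg fun k _ => by
        have hN : (1 : ℝ) ≤ Fintype.card (V k) := by exact_mod_cast Fintype.card_pos
        have := inv_le_one_of_one_le₀ hN
        linarith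
    have := mul_le_mul_of_nonneg_left hpot1 hC0
    linarith
  have hsub : ∀ m, n ≤ m → { ω | ¬ ∃ m, n ≤ m ∧ ∀ v w : V m,
      trace (fun k => Φ k ω) m v n = trace (fun k => Φ k ω) m w n } ⊆ A m :=
    fun m hm ω hω hc => hω ⟨m, hm, hc⟩
  rw [ae_iff]
  have : P.real { ω | ¬ ∃ m, n ≤ m ∧ ∀ v w : V m,
      trace (fun k => Φ k ω) m v n = trace (fun k => Φ k ω) m w n } ≤ 0 := by
    refine ge_of_tendsto hlim ?_
    filter_upwards [eventually_ge_atTop n] with m hm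
    exact (measureReal_mono (hsub m hm)).trans (hA m hm)
  exact (measureReal_eq_zero_iff).1 (le_antisymm this measureReal_nonneg)

theorem real_trace_eq_le {l m : ℕ} (hlm : l ≤ m) {v v' : V m} (hv : v ≠ v') :
    P.real { ω | trace (fun k => Φ k ω) m v l = trace (fun k => Φ k ω) m v' l } ≤
      ∑ k ∈ Finset.Ico l m, (Fintype.card (V k) : ℝ)⁻¹ := by
  classical
  induction m, hlm using Nat.le_induction with
  | base => simp [hv]
  | succ m hlm ih =>
    set τ := ∑ k ∈ Finset.Ico l m, (Fintype.card (V k) : ℝ)⁻¹ with hτ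
    let D : V m → V m → Set Ω := fun w w' =>
      { ω | trace (fun k => Φ k ω) m w l = trace (fun k => Φ k ω) m w' l }
    have hD : ∀ w w', MeasurableSet[h.past m] (D w w') := fun w w' =>
      h.measurable_traces m l (Set.toFinite { g : V m → V l | g w = g w' }).measurableSet
    have hsub : { ω | trace (fun k => Φ k ω) (m + 1) v l = trace (fun k => Φ k ω) (m + 1) v' l } ⊆
        ⋃ p ∈ (Finset.univ : Finset (V m × V m)),
          D p.1 p.2 ∩ { ω | Φ m ω v = p.1 ∧ Φ m ω v' = p.2 } := by
      intro ω hω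
      simp only [Set.mem_ofPred_eq, trace_succ _ hlm] at hω
      simp only [Set.mem_iUnion]
      exact ⟨(Φ m ω v, Φ m ω v'), Finset.mem_univ _, hω, rfl, rfl⟩
    refine (measureReal_mono hsub (measure_ne_top _ _)).trans
      ((measureReal_biUnion_finset_le _ _).trans ?_)
    simp_rw [h.real_inter_parent_pair (hD _ _) hv]
    rw [← Finset.sum_mul, Finset.sum_Ico_succ_top hlm, ← hτ, Fintype.sum_prod_type]
    refine (mul_le_mul_of_nonneg_right (sum_sum_le_of_le_ite (τ := τ)
      (Finset.sum_nonneg fun _ _ => by positivity) fun w w' => ?_) (by positivity)).trans_eq ?_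
    · split_ifs with hw
      · exact measureReal_le_one
      · exact ih hw
    · have hN : (Fintype.card (V m) : ℝ) ≠ 0 := by simp
      field_simp
      ring

theorem measurable_share (l : ℕ) (u : V l) (m : ℕ) :
    Measurable[h.past m] fun ω => share (fun k => Φ k ω) l u m := by
  classical
  exact (Measurable.of_discrete (f := fun g : V m → V l => (Fintype.card (V m) : ℝ)⁻¹ *
    ∑ v : V m, if g v = u then (1 : ℝ) else 0)).comp (h.measurable_traces m l)

theorem integral_sum_share_sq_le {l m : ℕ} (hlm : l ≤ m) :
    ∫ ω, ∑ u : V l, share (fun k => Φ k ω) l u m ^ 2 ∂P ≤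
      ∑ k ∈ Finset.Ico l (m + 1), (Fintype.card (V k) : ℝ)⁻¹ := by
  classical
  set τ := ∑ k ∈ Finset.Ico l m, (Fintype.card (V k) : ℝ)⁻¹ with hτ
  let D : V m → V m → Set Ω := fun w w' =>
    { ω | trace (fun k => Φ k ω) m w l = trace (fun k => Φ k ω) m w' l }
  have hD : ∀ w w', MeasurableSet (D w w') := fun w w' => h.past.le m _
    (h.measurable_traces m l (Set.toFinite { g : V m → V l | g w = g w' }).measurableSet)
  have e : ∀ ω, ∑ u : V l, share (fun k => Φ k ω) l u m ^ 2 =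
      (∑ w : V m, ∑ w' : V m, (D w w').indicator (fun _ => (1 : ℝ)) ω) *
        ((Fintype.card (V m) : ℝ)⁻¹ * (Fintype.card (V m) : ℝ)⁻¹) := by
    intro ω
    have : ∀ u : V l, share (fun k => Φ k ω) l u m ^ 2 =
        (∑ w : V m, ∑ w' : V m, (if trace (fun k => Φ k ω) m w l = u then
          (if trace (fun k => Φ k ω) m w' l = u then 1 else 0) else (0 : ℝ))) *
        ((Fintype.card (V m) : ℝ)⁻¹ * (Fintype.card (V m) : ℝ)⁻¹) := by
      intro u
      rw [share, mul_pow, sq (Finset.sum _ _), Finset.sum_mul_sum]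
      simp only [ite_mul, one_mul, zero_mul]
      ring
    simp_rw [this]
    rw [← Finset.sum_mul, Finset.sum_comm]
    congr 1
    refine Finset.sum_congr rfl fun w _ => ?_
    rw [Finset.sum_comm]
    refine Finset.sum_congr rfl fun w' _ => ?_
    rw [Finset.sum_ite_eq, if_pos (Finset.mem_univ _), Set.indicator_apply]
    simp only [D, Set.mem_ofPred_eq, eq_comm]
  simp_rw [e]
  have hint : ∀ w w', Integrable ((D w w').indicator fun _ => (1 : ℝ)) P := fun w w' =>
    (integrable_const _).indicator (hD w w')
  rw [integral_mul_const, integral_finsetSum _ fun w _ => integrable_finsetSum _ fun w' _ =>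
    hint w w']
  simp_rw [integral_finsetSum Finset.univ fun w' _ => hint _ w',
    integral_indicator_const _ (hD _ _), smul_eq_mul, mul_one]
  rw [Finset.sum_Ico_succ_top hlm, ← hτ]
  refine (mul_le_mul_of_nonneg_right (sum_sum_le_of_le_ite (τ := τ)
    (Finset.sum_nonneg fun _ _ => by positivity) fun w w' => ?_) (by positivity)).trans_eq ?_
  · split_ifs with hw
    · exact measureReal_le_one
    · exact h.real_trace_eq_le hlm hw
  · have hN : (Fintype.card (V m) : ℝ) ≠ 0 := by simp
    field_simp
    ring

theorem integrable_share (l : ℕ) (u : V l) (m : ℕ) :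
    Integrable (fun ω => share (fun k => Φ k ω) l u m) P :=
  Integrable.of_bound ((h.measurable_share l u m).mono (h.past.le m) le_rfl).aestronglyMeasurable
    1 (ae_of_all _ fun ω => by
      rw [Real.norm_of_nonneg (share_nonneg _ _ _ _)]
      exact share_le_one _ _ _ _)

theorem setIntegral_share (l : ℕ) (u : V l) (m : ℕ) (s : Set Ω) :
    ∫ ω in s, share (fun k => Φ k ω) l u m ∂P = (Fintype.card (V m) : ℝ)⁻¹ *
      ∑ v : V m, P.real (s ∩ { ω | trace (fun k => Φ k ω) m v l = u }) := by
  classical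
  have hA : ∀ v : V m, MeasurableSet { ω | trace (fun k => Φ k ω) m v l = u } := fun v =>
    h.past.le m _ (h.measurable_trace m l v (measurableSet_singleton u))
  have e : ∀ ω, share (fun k => Φ k ω) l u m = (Fintype.card (V m) : ℝ)⁻¹ *
      ∑ v : V m, Set.indicator { ω | trace (fun k => Φ k ω) m v l = u } (fun _ => (1 : ℝ)) ω := by
    intro ω
    simp only [share, Set.indicator_apply, Set.mem_ofPred_eq]
  simp_rw [e]
  rw [integral_const_mul, integral_finsetSum]
  · congr 1
    refine Finset.sum_congr rfl fun v _ => ?_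
    rw [integral_indicator_const _ (hA v), measureReal_restrict_apply (hA v), smul_eq_mul, mul_one,
      Set.inter_comm]
  · exact fun v _ => (integrable_const _).indicator (hA v)

theorem setIntegral_share_succ {l m : ℕ} (hlm : l ≤ m) (u : V l) {s : Set Ω}
    (hs : MeasurableSet[h.past m] s) :
    ∫ ω in s, share (fun k => Φ k ω) l u m ∂P =
      ∫ ω in s, share (fun k => Φ k ω) l u (m + 1) ∂P := by
  rw [h.setIntegral_share, h.setIntegral_share]
  let A : V m → Set Ω := fun w => s ∩ { ω | trace (fun k => Φ k ω) m w l = u }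
  have hA : ∀ w, MeasurableSet[h.past m] (A w) := fun w =>
    hs.inter (h.measurable_trace m l w (measurableSet_singleton u))
  have key : ∀ v : V (m + 1),
      P.real (s ∩ { ω | trace (fun k => Φ k ω) (m + 1) v l = u }) =
        (Fintype.card (V m) : ℝ)⁻¹ * ∑ w : V m, P.real (A w) := by
    intro v
    have e : s ∩ { ω | trace (fun k => Φ k ω) (m + 1) v l = u } =
        ⋃ w ∈ (Finset.univ : Finset (V m)), A w ∩ { ω | Φ m ω v = w } := by
      ext ω
      simp [A, trace_succ _ hlm]
    rw [e, measureReal_biUnion_finset]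
    · simp_rw [h.real_inter_parent (hA _)]
      rw [← Finset.sum_mul, mul_comm]
    · intro w _ w' _ hww
      refine Set.disjoint_left.2 fun ω hω hω' => hww ?_
      exact hω.2.symm.trans hω'.2
    · exact fun w _ => (h.past.le m _ (hA w)).inter
        (h.measurable_parent m v (measurableSet_singleton w))
  simp_rw [key]
  have hN : (Fintype.card (V (m + 1)) : ℝ) ≠ 0 := by simp
  simp [A]

theorem ae_exists_tendsto_share (l : ℕ) (u : V l) :
    ∀ᵐ ω ∂P, ∃ c, Tendsto (share (fun k => Φ k ω) l u) atTop (𝓝 c) := by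
  let ℱ : Filtration ℕ (‹_› : MeasurableSpace Ω) :=
    { seq := fun k => h.past (l + k)
      mono' := fun i j hij => h.past.mono (by omega)
      le' := fun k => h.past.le _ }
  have hmart : Martingale (fun k ω => share (fun k => Φ k ω) l u (l + k)) ℱ P :=
    martingale_of_setIntegral_eq_succ
      (fun k => (h.measurable_share l u (l + k)).stronglyMeasurable)
      (fun k => h.integrable_share l u (l + k))
      (fun k s hs => h.setIntegral_share_succ (Nat.le_add_right l k) u hs)
  have := hmart.submartingale.exists_ae_tendsto_of_bdd (R := 1) fun k => by
    refine (eLpNorm_le_of_ae_bound (C := 1) (ae_of_all _ fun ω => ?_)).trans ?_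
    · rw [Real.norm_of_nonneg (share_nonneg _ _ _ _)]
      exact share_le_one _ _ _ _
    · simp
  filter_upwards [this] with ω hω
  obtain ⟨c, hc⟩ := hω
  refine ⟨c, (tendsto_add_atTop_iff_nat l).1 ?_⟩
  simpa only [add_comm] using hc

theorem ae_not_countable_lines (hsum : Summable fun n => (Fintype.card (V n) : ℝ)⁻¹) :
    ∀ᵐ ω ∂P, ¬ (lines fun k => Φ k ω).Countable := by
  let S : ℕ → ℕ → Ω → ENNReal := fun l m ω =>
    ENNReal.ofReal (∑ u : V l, share (fun k => Φ k ω) l u m ^ 2)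
  have hS : ∀ l m, Measurable (S l m) := fun l m => ENNReal.measurable_ofReal.comp
    (Finset.measurable_fun_sum _ fun u _ =>
      ((h.measurable_share l u m).mono (h.past.le m) le_rfl).pow_const 2)
  let Q : ℕ → Ω → ENNReal := fun l ω => liminf (fun m => S l m ω) atTop
  have hQm : ∀ l, Measurable (Q l) := fun l => Measurable.liminf (hS l)
  have hQ : ∀ l, ∫⁻ ω, Q l ω ∂P ≤ ENNReal.ofReal (∑' k, (Fintype.card (V (k + l)) : ℝ)⁻¹) := by
    intro l
    refine (lintegral_liminf_le (hS l)).trans (liminf_le_of_frequently_le' ?_)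
    refine (Filter.Eventually.frequently ?_)
    filter_upwards [eventually_ge_atTop l] with m hm
    rw [← ofReal_integral_eq_lintegral_ofReal]
    · refine ENNReal.ofReal_le_ofReal ((h.integral_sum_share_sq_le hm).trans ?_)
      rw [Finset.sum_Ico_eq_sum_range]
      simp_rw [add_comm l]
      exact ((summable_nat_add_iff l).2 hsum).sum_le_tsum _ fun k _ => by positivity
    · refine integrable_finsetSum _ fun u _ => Integrable.of_bound
        (((h.measurable_share l u m).mono (h.past.le m) le_rfl).pow_const 2).aestronglyMeasurable
        1 (ae_of_all _ fun ω => ?_)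
      rw [Real.norm_of_nonneg (by positivity)]
      exact pow_le_one₀ (share_nonneg _ _ _ _) (share_le_one _ _ _ _)
    · exact ae_of_all _ fun ω => Finset.sum_nonneg fun u _ => sq_nonneg _
  have hlim : Tendsto (fun l => ENNReal.ofReal (∑' k, (Fintype.card (V (k + l)) : ℝ)⁻¹)) atTop
      (𝓝 0) := by
    simpa using ENNReal.tendsto_ofReal
      (tendsto_sum_nat_add fun n => (Fintype.card (V n) : ℝ)⁻¹)
  have hzero : ∫⁻ ω, liminf (fun l => Q l ω) atTop ∂P = 0 := by
    refine le_antisymm ((lintegral_liminf_le hQm).trans ?_) zero_le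
    exact (liminf_le_liminf (Eventually.of_forall hQ)).trans hlim.liminf_eq.le
  have hae := (lintegral_eq_zero_iff (Measurable.liminf hQm)).1 hzero
  have hconv : ∀ᵐ ω ∂P, ∀ l (u : V l), ∃ c,
      Tendsto (share (fun k => Φ k ω) l u) atTop (𝓝 c) :=
    ae_all_iff.2 fun l => ae_all_iff.2 fun u => h.ae_exists_tendsto_share l u
  filter_upwards [hae, hconv] with ω hω hc
  choose q hq using hc
  refine not_countable_lines_of_tendsto_share _ q hq fun ε hε n => ?_
  have hQq : ∀ l, Q l ω = ENNReal.ofReal (∑ u : V l, q l u ^ 2) := fun l =>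
    (ENNReal.tendsto_ofReal (tendsto_finsetSum _ fun u _ => (hq l u).pow 2)).liminf_eq
  have hfreq : ∃ᶠ l in atTop, Q l ω < ENNReal.ofReal ε := by
    refine frequently_lt_of_liminf_lt (by isBoundedDefault) ?_
    rw [hω]
    simpa using hε
  obtain ⟨l, hl, hlε⟩ := (frequently_atTop.1 hfreq) (n + 1)
  rw [hQq] at hlε
  exact ⟨l, hl, (ENNReal.ofReal_lt_ofReal_iff hε).1 hlε⟩

end IsUniform

end Random

end ParentMaps

namespace BratteliDiagram

variable (B : BratteliDiagram)

instance (n : ℕ) : MeasurableSpace (B.V n) := ⊤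

instance (n : ℕ) : DiscreteMeasurableSpace (B.V n) := ⟨fun _ => trivial⟩

instance (i : B.VtxIdx) : DiscreteMeasurableSpace (B.OrdAt i) := ⟨fun _ => trivial⟩

instance (i : B.VtxIdx) : Finite (B.EdgesTo i) := Subtype.finite

instance (i : B.VtxIdx) : Nonempty (B.EdgesTo i) :=
  let ⟨e, he⟩ := B.rng_surj i.1 i.2
  ⟨⟨e, he⟩⟩

instance (i : B.VtxIdx) : Nonempty (B.OrdAt i) := ⟨Finite.equivFin _⟩

instance (i : B.VtxIdx) : Finite (B.OrdAt i) :=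
  Finite.of_injective (fun σ : B.OrdAt i => (σ : B.EdgesTo i → Fin (Nat.card (B.EdgesTo i))))
    DFunLike.coe_injective

/-- The greatest position in the enumeration of `r⁻¹(i)`. -/
noncomputable def lastIdx (i : B.VtxIdx) : Fin (Nat.card (B.EdgesTo i)) :=
  ⟨Nat.card (B.EdgesTo i) - 1, Nat.sub_lt Nat.card_pos one_pos⟩

variable {B}

/-- The source of the maximal edge with range `i`, for an order on `r⁻¹(i)`. -/
noncomputable def maxSrc (i : B.VtxIdx) (σ : B.OrdAt i) : B.V i.1 :=
  B.src i.1 (σ.symm (B.lastIdx i)).1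

/-- The source of the maximal edge with range `v`. -/
noncomputable def maxParent (n : ℕ) (ω : B.OrderSpace) (v : B.V (n + 1)) : B.V n :=
  maxSrc ⟨n, v⟩ (ω ⟨n, v⟩)

theorem isMaxPathOrd_iff (ω : B.OrderSpace) (x : B.PathSpace) :
    B.IsMaxPathOrd ω x ↔ ∀ n, x.1 n =
      ((ω ⟨n, B.rng n (x.1 n)⟩).symm (B.lastIdx ⟨n, B.rng n (x.1 n)⟩)).1 := by
  refine forall_congr' fun n => ⟨fun h => ?_, fun h e' => ?_⟩
  · have h1 := h ((ω ⟨n, B.rng n (x.1 n)⟩).symm (B.lastIdx ⟨n, B.rng n (x.1 n)⟩))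
    rw [Equiv.apply_symm_apply] at h1
    have h2 : ω ⟨n, B.rng n (x.1 n)⟩ ⟨x.1 n, rfl⟩ = B.lastIdx ⟨n, B.rng n (x.1 n)⟩ :=
      le_antisymm (Nat.le_sub_one_of_lt (Fin.is_lt _)) h1
    exact congrArg Subtype.val ((Equiv.eq_symm_apply _).2 h2)
  · have h1 : (⟨x.1 n, rfl⟩ : B.EdgesTo ⟨n, B.rng n (x.1 n)⟩) =
        (ω ⟨n, B.rng n (x.1 n)⟩).symm (B.lastIdx ⟨n, B.rng n (x.1 n)⟩) := Subtype.ext h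
    rw [h1, Equiv.apply_symm_apply]
    exact Nat.le_sub_one_of_lt (Fin.is_lt _)

theorem IsMaxPathOrd.eq_maxEdge {ω : B.OrderSpace} {x : B.PathSpace} (hx : B.IsMaxPathOrd ω x)
    (n : ℕ) : x.1 n = ((ω ⟨n, B.endVtx (n + 1) x⟩).symm (B.lastIdx _)).1 := by
  have h := (isMaxPathOrd_iff ω x).1 hx n
  rwa [x.2 n] at h

/-- Passing to the sequence of vertices identifies the maximal paths with the infinite lines of
the maps sending a vertex to the source of its maximal incoming edge. -/
theorem bijOn_endVtx (ω : B.OrderSpace) :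
    Set.BijOn (fun (x : B.PathSpace) n => B.endVtx n x) { x | B.IsMaxPathOrd ω x }
      (ParentMaps.lines fun n => maxParent n ω) := by
  refine ⟨fun x hx n => ?_, fun x hx y hy hxy => ?_, fun y hy => ?_⟩
  · exact (congrArg (B.src n) (hx.eq_maxEdge n)).symm
  · refine Subtype.ext (funext fun n => ?_)
    have hn : B.endVtx (n + 1) x = B.endVtx (n + 1) y := congrFun hxy (n + 1)
    rw [IsMaxPathOrd.eq_maxEdge hx n, IsMaxPathOrd.eq_maxEdge hy n, hn]
  · let e : ∀ n, B.EdgesTo ⟨n, y (n + 1)⟩ := fun n => (ω ⟨n, y (n + 1)⟩).symm (B.lastIdx _)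
    have hsrc : ∀ n, B.src n (e n).1 = y n := hy
    have hrng : ∀ n, B.rng n (e n).1 = y (n + 1) := fun n => (e n).2
    refine ⟨⟨fun n => (e n).1, fun n => (hrng n).trans (hsrc (n + 1)).symm⟩, ?_, funext hsrc⟩
    refine (isMaxPathOrd_iff _ _).2 fun n => ?_
    change (e n).1 = ((ω ⟨n, B.rng n (e n).1⟩).symm (B.lastIdx ⟨n, B.rng n (e n).1⟩)).1
    rw [hrng n]

theorem measurable_order (i : B.VtxIdx) : Measurable fun ω : B.OrderSpace => ω i :=
  measurable_pi_apply (X := fun i => B.OrdAt i) i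

theorem IsUniformOrderMeasure.measure_forall_mem {P : Measure B.OrderSpace}
    (hP : B.IsUniformOrderMeasure P) (s : Finset B.VtxIdx) (t : ∀ i, Set (B.OrdAt i)) :
    P { ω | ∀ i ∈ s, ω i ∈ t i } = ∏ i ∈ s, uniformOn Set.univ (t i) := by
  classical
  have := hP.1
  let r : B.OrderSpace → ∀ i : s, B.OrdAt i := fun ω i => ω i
  have hr : Measurable r := measurable_pi_lambda _ fun i => measurable_order _
  have hmap : P.map r = Measure.pi fun i : s => (uniformOn Set.univ : Measure (B.OrdAt i)) := by
    refine Measure.ext_of_singleton fun x => ?_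
    rw [Measure.map_apply hr (measurableSet_singleton x), Measure.pi_singleton]
    let ω₀ : B.OrderSpace := fun i => if h : i ∈ s then x ⟨i, h⟩ else Classical.arbitrary _
    have e : r ⁻¹' {x} = { ω | ∀ i ∈ s, ω i = ω₀ i } := by
      ext ω
      simp only [Set.mem_preimage, Set.mem_singleton_iff, funext_iff, Subtype.forall, r, ω₀]
      refine forall₂_congr fun i hi => ?_
      rw [dif_pos hi]
    rw [e, hP.2, ← Finset.prod_coe_sort]
    refine Finset.prod_congr rfl fun i _ => ?_
    have := Fintype.ofFinite (B.OrdAt i)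
    rw [uniformOn_univ, Measure.count_singleton, Nat.card_eq_fintype_card, one_div]
  have e : { ω | ∀ i ∈ s, ω i ∈ t i } = r ⁻¹' Set.univ.pi fun i : s => t i := by
    ext ω
    simp [r, Set.mem_pi]
  rw [e, ← Measure.map_apply hr (Set.toFinite _).measurableSet, hmap, Measure.pi_pi,
    Finset.prod_coe_sort s fun i => uniformOn Set.univ (t i)]

theorem IsUniformOrderMeasure.measure_mem {P : Measure B.OrderSpace}
    (hP : B.IsUniformOrderMeasure P) (i : B.VtxIdx) (t : Set (B.OrdAt i)) :
    P { ω | ω i ∈ t } = uniformOn Set.univ t := by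
  classical
  have h := hP.measure_forall_mem {i} fun j => if h : j = i then h ▸ t else ∅
  simpa using h

theorem IsUniformOrderMeasure.iIndepFun_order {P : Measure B.OrderSpace}
    (hP : B.IsUniformOrderMeasure P) : iIndepFun (fun i (ω : B.OrderSpace) => ω i) P := by
  refine iIndepFun_iff_measure_inter_preimage_eq_mul.2 fun s t _ => ?_
  have e : (⋂ i ∈ s, (fun ω : B.OrderSpace => ω i) ⁻¹' t i) = { ω | ∀ i ∈ s, ω i ∈ t i } := by
    ext ω
    simp
  rw [e, hP.measure_forall_mem]
  exact Finset.prod_congr rfl fun i _ => (hP.measure_mem i (t i)).symm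

theorem uniformOn_symm_lastIdx (i : B.VtxIdx) (e : B.EdgesTo i) :
    (uniformOn Set.univ : Measure (B.OrdAt i)).real { σ | σ.symm (B.lastIdx i) = e } =
      (Nat.card (B.EdgesTo i) : ℝ)⁻¹ := by
  classical
  have := Fintype.ofFinite (B.EdgesTo i)
  have := Fintype.ofFinite (B.OrdAt i)
  set μ : Measure (B.OrdAt i) := uniformOn Set.univ with hμ
  let A : B.EdgesTo i → Set (B.OrdAt i) := fun e => { σ | σ.symm (B.lastIdx i) = e }
  have hA : ∀ e e', μ.real (A e) = μ.real (A e') := by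
    intro e e'
    let T : B.OrdAt i → B.OrdAt i := fun σ => (Equiv.swap e e').trans σ
    have hT : Function.Injective T := fun σ τ h => by
      ext x
      have := congrArg (fun ρ : B.OrdAt i => ρ (Equiv.swap e e' x)) h
      simpa [T] using congrArg Fin.val this
    have hpre : A e' = T '' A e := by
      ext σ
      constructor
      · intro hσ
        refine ⟨(Equiv.swap e e').trans σ, ?_, ?_⟩
        · have : σ.symm (B.lastIdx i) = e' := hσ
          simp [A, this]
        · ext x
          simp [T]
      · rintro ⟨τ, hτ, rfl⟩
        have : τ.symm (B.lastIdx i) = e := hτ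
        simp [A, T, this]
    rw [hpre, measureReal_def, measureReal_def, hμ, uniformOn_univ, uniformOn_univ,
      Measure.count_injective_image hT]
  have hsum : ∑ e', μ.real (A e') = 1 := by
    have hdisj : Set.PairwiseDisjoint (↑(Finset.univ : Finset (B.EdgesTo i))) A :=
      fun a _ b _ hab => Set.disjoint_left.2 fun σ h1 h2 => hab (Eq.trans (Eq.symm h1) h2)
    rw [← measureReal_biUnion_finset (μ := μ) hdisj fun _ _ => (Set.toFinite _).measurableSet]
    have : (⋃ e' ∈ (Finset.univ : Finset (B.EdgesTo i)), A e') = Set.univ := by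
      ext σ
      simp [A]
    rw [this, probReal_univ]
  rw [Finset.sum_congr rfl fun e' _ => hA e' e, Finset.sum_const, Finset.card_univ,
    nsmul_eq_mul] at hsum
  have hc : (Fintype.card (B.EdgesTo i) : ℝ) = Nat.card (B.EdgesTo i) := by
    rw [Nat.card_eq_fintype_card]
  exact eq_inv_of_mul_eq_one_right (hc ▸ hsum)

theorem bijective_src (h01 : ∀ (n : ℕ) (v : B.V (n + 1)) (w : B.V n), B.edgeCount n v w = 1)
    (i : B.VtxIdx) : Function.Bijective fun e : B.EdgesTo i => B.src i.1 e.1 := by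
  refine (Function.bijective_iff_existsUnique _).2 fun w => ?_
  obtain ⟨hs, ⟨e, he⟩⟩ := Nat.card_eq_one_iff_unique.1 (h01 i.1 i.2 w)
  refine ⟨⟨e, he.1⟩, he.2, fun e' he' => Subtype.ext ?_⟩
  exact Subtype.mk.inj (hs.elim ⟨e'.1, e'.2, he'⟩ ⟨e, he⟩)

theorem measurable_maxSrc (i : B.VtxIdx) : Measurable fun ω : B.OrderSpace => maxSrc i (ω i) :=
  (Measurable.of_discrete (f := maxSrc i)).comp (measurable_order i)

theorem IsUniformOrderMeasure.real_maxSrc_eq {P : Measure B.OrderSpace}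
    (hP : B.IsUniformOrderMeasure P)
    (h01 : ∀ (n : ℕ) (v : B.V (n + 1)) (w : B.V n), B.edgeCount n v w = 1)
    (i : B.VtxIdx) (w : B.V i.1) :
    P.real { ω | maxSrc i (ω i) = w } = (Fintype.card (B.V i.1) : ℝ)⁻¹ := by
  obtain ⟨e, he⟩ := (bijective_src h01 i).2 w
  have hset : { ω : B.OrderSpace | maxSrc i (ω i) = w } =
      { ω | ω i ∈ { σ : B.OrdAt i | σ.symm (B.lastIdx i) = e } } := by
    ext ω
    change B.src i.1 ((ω i).symm (B.lastIdx i)).1 = w ↔ (ω i).symm (B.lastIdx i) = e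
    rw [← he]
    exact (bijective_src h01 i).1.eq_iff
  rw [hset, measureReal_def, hP.measure_mem, ← measureReal_def, uniformOn_symm_lastIdx,
    Nat.card_congr (Equiv.ofBijective _ (bijective_src h01 i)), Nat.card_eq_fintype_card]

theorem IsUniformOrderMeasure.isUniform_maxParent {P : Measure B.OrderSpace}
    (hP : B.IsUniformOrderMeasure P)
    (h01 : ∀ (n : ℕ) (v : B.V (n + 1)) (w : B.V n), B.edgeCount n v w = 1) :
    ParentMaps.IsUniform P (maxParent (B := B)) where
  measurable_parent n v := measurable_maxSrc ⟨n, v⟩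
  iIndepFun_parent := hP.iIndepFun_order.comp (fun i => maxSrc i) fun _ => Measurable.of_discrete
  real_parent_eq n v w := hP.real_maxSrc_eq h01 ⟨n, v⟩ w

end BratteliDiagram

/-- **Janssen–Quas–Yassawi.** Let `B` be a Bratteli diagram all of whose incidence matrix
entries equal `1`, and let `P` be the uniform product measure on the space of orders of
`B`. If `Σ_n 1/|V_n| = ∞` then `P`-almost every order has a unique maximal path, while if
`Σ_n 1/|V_n| < ∞` then for `P`-almost every order the set of maximal paths is
uncountable. -/
theorem random_orders_on_zero_one_diagrams
    (B : BratteliDiagram)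
    (hCantor : ∀ x : B.PathSpace, ¬IsOpen ({x} : Set B.PathSpace))
    (h01 : ∀ (n : ℕ) (v : B.V (n + 1)) (w : B.V n), B.edgeCount n v w = 1)
    (P : Measure B.OrderSpace) (hP : B.IsUniformOrderMeasure P) :
    ((¬Summable fun n : ℕ => ((Nat.card (B.V (n + 1)) : ℝ))⁻¹) →
      P { ω : B.OrderSpace | ∃! x : B.PathSpace, B.IsMaxPathOrd ω x } = 1) ∧
    ((Summable fun n : ℕ => ((Nat.card (B.V (n + 1)) : ℝ))⁻¹) →
      P { ω : B.OrderSpace |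
        ¬({ x : B.PathSpace | B.IsMaxPathOrd ω x }).Countable } = 1) := by
  have := hP.1
  have hU := hP.isUniform_maxParent h01
  have hs : (Summable fun n : ℕ => ((Nat.card (B.V (n + 1)) : ℝ))⁻¹) ↔
      Summable fun n : ℕ => (Fintype.card (B.V n) : ℝ)⁻¹ := by
    simp_rw [Nat.card_eq_fintype_card]
    exact summable_nat_add_iff (f := fun n : ℕ => (Fintype.card (B.V n) : ℝ)⁻¹) 1
  refine ⟨fun hdiv => ?_, fun hsum => ?_⟩
  · have hae := hU.ae_exists_trace_eq (hs.not.1 hdiv)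
    refine (measure_congr (eventuallyEq_univ.2 ?_)).trans measure_univ
    filter_upwards [hae] with ω hω
    have hb := BratteliDiagram.bijOn_endVtx ω
    obtain ⟨y, hy, huniq⟩ := ParentMaps.existsUnique_mem_lines _ hω
    obtain ⟨x, hx, -⟩ := hb.surjOn hy
    exact ⟨x, hx, fun x' hx' => hb.injOn hx' hx
      ((huniq _ (hb.mapsTo hx')).trans (huniq _ (hb.mapsTo hx)).symm)⟩
  · have hae := hU.ae_not_countable_lines (hs.1 hsum)
    refine (measure_congr (eventuallyEq_univ.2 ?_)).trans measure_univ
    filter_upwards [hae] with ω hω hc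
    refine hω ?_
    rw [← (BratteliDiagram.bijOn_endVtx ω).image_eq]
    exact hc.image _
end
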